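/- arXiv:2204.06303 — 2 statements merged into one kernel-verified Lean document; each statement's English description precedes it below -/
import Mathlib

section
/- Let R be a commutative local ring. Then the following are equivalent: (i) the polynomial ring R[t] is Hermite; (ii) the Laurent polynomial ring R[t,t⁻¹] is Hermite; (iii) the ring R⟨t⟩ is Hermite; (iv) the formal Laurent series ring R((t)) is Hermite. -/
open Polynomial

/-- The multiplicative submonoid of monic polynomials in `R[t]`. -/
def monicSubmonoid (R : Type) [CommRing R] : Submonoid (Polynomial R) where
  carrier := {p | p.Monic}
  mul_mem' := fun ha hb => ha.mul hb
  one_mem' := monic_one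

/-- `R⟨t⟩`: the localization of `R[t]` at the multiplicative set of monic polynomials. -/
abbrev MonicLoc (R : Type) [CommRing R] :=
  Localization (monicSubmonoid R)

/-- A finitely generated module `P` over `A` is stably free if `P ⊕ Aᵐ ≅ Aⁿ` for some `m, n`. -/
def IsStablyFree (A : Type) [CommRing A] (P : Type) [AddCommGroup P] [Module A P] : Prop :=
  ∃ m n : ℕ, Nonempty ((P × (Fin m → A)) ≃ₗ[A] (Fin n → A))

/-- A commutative ring is Hermite if all finitely generated stably free modules are free. -/
def IsHermite (A : Type) [CommRing A] : Prop :=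
  ∀ (P : Type) [AddCommGroup P] [Module A P] [Module.Finite A P],
    IsStablyFree A P → Module.Free A P


namespace HermiteAux

open Matrix

/-- A row is completable if an invertible matrix carries it to a standard basis row. -/
def Compl {A : Type} [CommRing A] {n : ℕ} (v : Fin n → A) : Prop :=
  ∃ N : Matrix (Fin n) (Fin n) A, IsUnit N.det ∧ ∃ i, v ᵥ* N = Pi.single i 1

/-- Every unimodular row is completable. -/
def RowH (A : Type) [CommRing A] : Prop :=
  ∀ (n : ℕ) (v w : Fin n → A), v ⬝ᵥ w = 1 → Compl v

/-- Kernels of unimodular rows are free, in matrix form. -/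
def KerH (A : Type) [CommRing A] : Prop :=
  ∀ (n : ℕ) (v w : Fin n → A), v ⬝ᵥ w = 1 →
    ∃ (k : ℕ) (U : Matrix (Fin k) (Fin n) A) (X : Matrix (Fin n) (Fin k) A),
      U * X = 1 ∧ X * U = 1 - vecMulVec w v

lemma KerH.free_of_one {A : Type} [CommRing A] (h : KerH A) (P : Type) [AddCommGroup P]
    [Module A P] (n : ℕ) (e : (P × A) ≃ₗ[A] (Fin n → A)) : Module.Free A P := by
  set v : Fin n → A := fun i => (e.symm (Pi.single i 1)).2 with hv
  set w : Fin n → A := e (0, 1) with hw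
  have hvx : ∀ x : Fin n → A, v ⬝ᵥ x = (e.symm x).2 := by
    intro x
    conv_rhs => rw [pi_eq_sum_univ' x]
    simp only [map_sum, map_smul, Prod.snd_sum, Prod.smul_snd, smul_eq_mul]
    simp only [dotProduct, hv]
    refine Finset.sum_congr rfl fun i _ => ?_
    rw [mul_comm]
  have hvw : v ⬝ᵥ w = 1 := by rw [hvx, hw]; simp
  obtain ⟨k, U, X, h1, h2⟩ := h n v w hvw
  have hvX : ∀ y, v ⬝ᵥ (X *ᵥ y) = 0 := by
    intro y
    have : X *ᵥ y = (X * U) *ᵥ (X *ᵥ y) := by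
      rw [mulVec_mulVec, Matrix.mul_assoc, h1, Matrix.mul_one]
    rw [this, h2, sub_mulVec, one_mulVec, vecMulVec_mulVec]
    simp [dotProduct_sub, hvw]
  refine Module.Free.of_equiv (LinearEquiv.ofLinearMap
    (M := Fin k → A) (M₂ := P)
    (LinearMap.fst A P A ∘ₗ e.symm.toLinearMap ∘ₗ X.mulVecLin)
    (U.mulVecLin ∘ₗ e.toLinearMap ∘ₗ LinearMap.inl A P A) ?_ ?_)
  · ext x
    have hx : v ⬝ᵥ e (x, 0) = 0 := by rw [hvx]; simp
    simp only [LinearMap.comp_apply, mulVecLin_apply, mulVec_mulVec, h2, LinearMap.inl_apply,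
      LinearEquiv.coe_coe, sub_mulVec, one_mulVec, vecMulVec_mulVec, hx]
    simp
  · apply LinearMap.ext
    intro y
    have hy : e ((e.symm (X *ᵥ y)).1, 0) = X *ᵥ y := by
      rw [← e.symm.injective.eq_iff]
      ext
      · simp
      · rw [← hvx (X *ᵥ y), hvX]; simp
    simp only [LinearMap.comp_apply, mulVecLin_apply, LinearMap.inl_apply, LinearMap.fst_apply,
      LinearEquiv.coe_coe, hy, mulVec_mulVec, h1, one_mulVec, LinearMap.id_apply]

lemma KerH.isHermite {A : Type} [CommRing A] [Nontrivial A] (h : KerH A) : IsHermite A := by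
  intro P _ _ _ hP
  obtain ⟨m, n, ⟨e⟩⟩ := hP
  induction m generalizing n with
  | zero =>
    exact Module.Free.of_equiv (e.symm ≪≫ₗ LinearEquiv.prodUnique)
  | succ m ih =>
    have e2 : ((P × (Fin m → A)) × A) ≃ₗ[A] (Fin n → A) :=
      (LinearEquiv.prodAssoc A P (Fin m → A) A) ≪≫ₗ
        (LinearEquiv.prodCongr (LinearEquiv.refl A P)
          (LinearEquiv.prodComm A (Fin m → A) A ≪≫ₗ Fin.consLinearEquiv A (fun _ => A))) ≪≫ₗ e
    have hf := h.free_of_one _ n e2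
    have : Module.Finite A (P × (Fin m → A)) :=
      Module.Finite.of_surjective (LinearMap.fst A (P × (Fin m → A)) A ∘ₗ e2.symm.toLinearMap)
        (Prod.fst_surjective.comp e2.symm.surjective)
    exact ih _ (Module.finBasis A (P × (Fin m → A))).equivFun

lemma rowH_of_isHermite {A : Type} [CommRing A] [Nontrivial A] (h : IsHermite A) : RowH A := by
  intro n v w hvw
  let f : (Fin n → A) →ₗ[A] A := dotProductBilin A A v
  have hf : ∀ x, f x = v ⬝ᵥ x := fun x => rfl
  let P := LinearMap.ker f
  let e : (P × A) ≃ₗ[A] (Fin n → A) := LinearEquiv.ofLinearMap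
    (LinearMap.coprod P.subtype (LinearMap.toSpanSingleton A _ w))
    (LinearMap.prod (LinearMap.codRestrict P (LinearMap.id - (LinearMap.toSpanSingleton A _ w) ∘ₗ f)
      (by intro x; simp [P, hf, dotProduct_sub, dotProduct_smul, hvw])) f)
    (by
      apply LinearMap.ext; intro x; simp [hf])
    (by
      apply LinearMap.ext; rintro ⟨⟨x, hx⟩, a⟩
      have hx' : v ⬝ᵥ x = 0 := hx
      ext <;> simp [hf, dotProduct_add, hx', hvw, dotProduct_smul])
  have hfin : Module.Finite A P :=
      Module.Finite.of_surjective (LinearMap.fst A P A ∘ₗ e.symm.toLinearMap)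
        (Prod.fst_surjective.comp e.symm.surjective)
  have e1 : (P × (Fin 1 → A)) ≃ₗ[A] (Fin n → A) :=
    (LinearEquiv.prodCongr (LinearEquiv.refl A P) (LinearEquiv.funUnique (Fin 1) A A)) ≪≫ₗ e
  have hfree : Module.Free A P := h P ⟨1, n, ⟨e1⟩⟩
  have hn : n = Module.finrank A P + 1 := by
    have := e.finrank_eq
    simp at this
    exact this.symm
  obtain ⟨k, b, hn⟩ : ∃ (k : ℕ) (b : Module.Basis (Fin k) A P), n = k + 1 :=
    ⟨_, Module.finBasis A P, hn⟩
  subst hn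
  let g : (Fin (k+1) → A) ≃ₗ[A] (Fin (k+1) → A) :=
    (Fin.consLinearEquiv A (fun _ => A)).symm ≪≫ₗ
     (LinearEquiv.prodComm A A (Fin k → A)) ≪≫ₗ
      (LinearEquiv.prodCongr b.equivFun.symm (LinearEquiv.refl A A)) ≪≫ₗ e
  have hg : ∀ y, v ⬝ᵥ (g y) = y 0 := by
    intro y
    have : v ⬝ᵥ (g y) = (e.symm (g y)).2 := rfl
    rw [this]
    simp [g]
  refine ⟨LinearMap.toMatrix' g.toLinearMap, ?_, 0, ?_⟩
  · rw [LinearMap.det_toMatrix']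
    exact LinearEquiv.isUnit_det' g
  · ext j
    have : (v ᵥ* LinearMap.toMatrix' g.toLinearMap) j = v ⬝ᵥ (g (Pi.single j 1)) := by
      simp only [vecMul, LinearMap.toMatrix'_apply, dotProduct]
      refine Finset.sum_congr rfl fun i _ => ?_
      congr 3
    rw [this, hg]
    simp [Pi.single_apply, eq_comm]

lemma RowH.ker_aux {A : Type} [CommRing A] {n : ℕ} {v w : Fin n → A} (hvw : v ⬝ᵥ w = 1)
    (h : Compl v) : ∃ (U : Matrix (Fin (n-1)) (Fin n) A) (X : Matrix (Fin n) (Fin (n-1)) A),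
      U * X = 1 ∧ X * U = 1 - vecMulVec w v := by
  obtain ⟨N, hN, i, hi⟩ := h
  obtain _ | k := n
  · exact i.elim0
  have hNM : N * N⁻¹ = 1 := mul_nonsing_inv _ hN
  have hMN : N⁻¹ * N = 1 := nonsing_inv_mul _ hN
  have hv : v = N⁻¹ i := by
    have : v = (Pi.single i 1) ᵥ* N⁻¹ := by rw [← hi, vecMul_vecMul, hNM, vecMul_one]
    rw [this, single_one_vecMul]; rfl
  -- crude kernel
  let U : Matrix (Fin k) (Fin (k+1)) A := N⁻¹.submatrix i.succAbove id
  let X : Matrix (Fin (k+1)) (Fin k) A := N.submatrix id i.succAbove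
  have hUX : U * X = 1 := by
    have : U * X = (N⁻¹ * N).submatrix i.succAbove i.succAbove := by
      rw [submatrix_mul _ _ _ id _ Function.bijective_id]
    rw [this, hMN, submatrix_one _ i.succAbove_right_injective]
  have hXU : X * U = 1 - vecMulVec (fun a => N a i) v := by
    rw [← hNM]
    ext a b
    simp only [mul_apply, Matrix.sub_apply, vecMulVec_apply, X, U, submatrix_apply, id]
    rw [Fin.sum_univ_succAbove _ i, hv]
    ring
  have hvX : v ᵥ* X = 0 := by
    ext a
    have : (v ᵥ* X) a = (v ᵥ* N) (i.succAbove a) := rfl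
    rw [this, hi]
    simp [Pi.single_apply, Fin.succAbove_ne]
  refine ⟨U - vecMulVec (U *ᵥ w) v, X, ?_, ?_⟩
  · rw [Matrix.sub_mul, hUX, vecMulVec_mul, hvX]
    simp
  · rw [Matrix.mul_sub, hXU, mul_vecMulVec, mulVec_mulVec, hXU, sub_mulVec, vecMulVec_mulVec, hvw]
    simp [sub_vecMulVec]

lemma RowH.kerH {A : Type} [CommRing A] (h : RowH A) : KerH A :=
  fun n v w hvw => ⟨n-1, RowH.ker_aux hvw (h n v w hvw)⟩

lemma isHermite_iff_rowH {A : Type} [CommRing A] [Nontrivial A] : IsHermite A ↔ RowH A :=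
  ⟨rowH_of_isHermite, fun h => h.kerH.isHermite⟩


section compl
variable {A : Type} [CommRing A] {n : ℕ}

lemma Compl.map {B : Type} [CommRing B] (f : A →+* B) {v : Fin n → A} (h : Compl v) :
    Compl (fun i => f (v i)) := by
  obtain ⟨N, hN, i, hi⟩ := h
  refine ⟨N.map f, ?_, i, ?_⟩
  · have : (N.map f).det = f N.det := (RingHom.map_det f N).symm
    rw [this]; exact hN.map f
  · ext j
    have := congrArg f (congrFun hi j)
    simp only [vecMul, dotProduct, map_sum, map_mul] at this
    simp only [vecMul, dotProduct, Matrix.map_apply, this]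
    by_cases h : j = i
    · subst h; simp
    · simp [Pi.single_apply, h]

lemma Compl.of_mul {v : Fin n → A} {M : Matrix (Fin n) (Fin n) A} (hM : IsUnit M.det)
    (h : Compl (v ᵥ* M)) : Compl v := by
  obtain ⟨N, hN, i, hi⟩ := h
  exact ⟨M * N, by rw [det_mul]; exact hM.mul hN, i, by rw [← vecMul_vecMul, hi]⟩

lemma Compl.of_isUnit_apply {v : Fin n → A} {i : Fin n} (h : IsUnit (v i)) : Compl v := by
  have hd : ((1 : Matrix (Fin n) (Fin n) A).updateRow i v).det = v i := by
    have := det_updateRow_sum (1 : Matrix (Fin n) (Fin n) A) i v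
    rw [det_one, smul_eq_mul, mul_one] at this
    rw [← this]
    congr 2
    ext j
    simp [Matrix.one_apply]
  set M := (1 : Matrix (Fin n) (Fin n) A).updateRow i v with hM
  have hu : IsUnit M.det := by rw [hd]; exact h
  have hv : v = Pi.single i 1 ᵥ* M := by
    rw [single_one_vecMul]; ext j; simp [hM]
  refine ⟨M⁻¹, ?_, i, ?_⟩
  · rw [det_nonsing_inv]; exact hu.ringInverse
  · conv_lhs => rw [hv]
    rw [vecMul_vecMul, mul_nonsing_inv _ hu, vecMul_one]

lemma Compl.of_smul {v : Fin n → A} {c : A} (hc : IsUnit c) (h : Compl (c • v)) : Compl v := by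
  refine Compl.of_mul (M := c • (1 : Matrix (Fin n) (Fin n) A)) ?_ ?_
  · rw [det_smul, det_one, mul_one]; exact hc.pow _
  · rw [vecMul_smul, vecMul_one]; exact h

lemma Compl.of_smul' {v : Fin n → A} {c : A} (hc : IsUnit c) (h : Compl v) : Compl (c • v) := by
  obtain ⟨u, rfl⟩ := hc
  refine Compl.of_smul (c := ↑u⁻¹) (Units.isUnit _) ?_
  rw [smul_smul]; simpa using h

lemma Compl.of_add {v w u : Fin n → A} (hvw : v ⬝ᵥ w = 1) (hu : IsUnit (1 + u ⬝ᵥ w))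
    (h : Compl (v + u)) : Compl v := by
  refine Compl.of_mul (M := 1 + vecMulVec w u) ?_ ?_
  · rw [vecMulVec_eq Unit, det_one_add_replicateCol_mul_replicateRow]; exact hu
  · rw [vecMul_add, vecMul_one, vecMul_vecMulVec, hvw, one_smul]; exact h

end compl

/-- Abstract comparison of unimodular rows along a dense map into a filtered ring. -/
lemma rowH_iff_of_filtration {B L : Type} [CommRing B] [CommRing L] (ι : B →+* L)
    (F : ℤ → AddSubgroup L) (hmono : ∀ a b, a ≤ b → F b ≤ F a)
    (hmul : ∀ a b x y, x ∈ F a → y ∈ F b → x * y ∈ F (a + b))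
    (hone : (1 : L) ∈ F 0)
    (hex : ∀ x, ∃ N : ℕ, x ∈ F (-N))
    (hdense : ∀ x (N : ℤ), ∃ b, x - ι b ∈ F N)
    (hunit : ∀ x, x - 1 ∈ F 1 → IsUnit x)
    (hunitB : ∀ b, ι b - 1 ∈ F 1 → IsUnit b) : RowH B ↔ RowH L := by
  have hex' : ∀ (κ : Type) [Fintype κ] (x : κ → L), ∃ N : ℕ, ∀ i, x i ∈ F (-N) := by
    intro κ _ x
    choose N hN using fun i => hex (x i)
    refine ⟨∑ i, N i, fun i => hmono _ _ ?_ (hN i)⟩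
    have := Finset.single_le_sum (f := N) (fun _ _ => Nat.zero_le _) (Finset.mem_univ i)
    omega
  constructor
  · intro h n v w hvw
    obtain ⟨N, hN⟩ := hex' _ w
    choose b hb using fun i => hdense (v i) (N + 1)
    set u : Fin n → L := fun i => ι (b i) - v i with hu
    have huF : ∀ i, u i ∈ F (N + 1) := fun i => by
      have := (F (N+1)).neg_mem (hb i); simpa [hu] using this
    have huw : u ⬝ᵥ w ∈ F 1 := by
      refine (F 1).sum_mem fun i _ => ?_
      have := hmul _ _ _ _ (huF i) (hN i)
      simpa using this
    have hvu : v + u = fun i => ι (b i) := by ext i; simp [hu]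
    refine Compl.of_add hvw (hunit _ (by simpa using huw)) ?_
    rw [hvu]
    apply Compl.map
    obtain ⟨K, hK⟩ := hex' _ (fun i => ι (b i))
    choose c hc using fun i => hdense (w i) (K + 1)
    have hbc : ι (b ⬝ᵥ c) - 1 ∈ F 1 := by
      have e : ι (b ⬝ᵥ c) - 1 = u ⬝ᵥ w - (fun i => ι (b i)) ⬝ᵥ (fun i => w i - ι (c i)) := by
        have h1 : (fun i => ι (b i)) ⬝ᵥ w = 1 + u ⬝ᵥ w := by rw [← hvu, add_dotProduct, hvw]
        have h2 : (fun i => w i - ι (c i)) = w - fun i => ι (c i) := rfl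
        rw [h2, dotProduct_sub, h1]
        simp [dotProduct]
        ring
      rw [e]
      refine (F 1).sub_mem huw ((F 1).sum_mem fun i _ => ?_)
      have := hmul _ _ _ _ (hK i) (hc i)
      simpa using this
    obtain ⟨y, hy⟩ := (hunitB _ hbc).exists_right_inv
    refine h n b (y • c) ?_
    rw [dotProduct_smul, smul_eq_mul, mul_comm, hy]
  · intro h n v w hvw
    obtain ⟨N, hN, i, hi⟩ := h n (fun i => ι (v i)) (fun i => ι (w i)) (by
      have := congrArg ι hvw
      simpa [dotProduct] using this)
    obtain ⟨K1, hK1⟩ := hex' _ (fun i => ι (v i))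
    obtain ⟨K2, hK2⟩ := hex' (Fin n × Fin n) (fun p => N⁻¹ p.1 p.2)
    choose N' hN' using fun a b => hdense (N a b) (K1 + K2 + 1)
    obtain ⟨K3, hK3⟩ := hex' (Fin n × Fin n) (fun p => ι (N' p.1 p.2))
    choose M' hM' using fun a b => hdense (N⁻¹ a b) (K3 + 1)
    let NN : Matrix (Fin n) (Fin n) B := Matrix.of N'
    let MM : Matrix (Fin n) (Fin n) B := Matrix.of M'
    have hprod : ∀ a b, ι ((NN * MM) a b) - (1 : Matrix (Fin n) (Fin n) L) a b ∈ F 1 := by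
      intro a b
      have e : ι ((NN * MM) a b) - (1 : Matrix (Fin n) (Fin n) L) a b
          = - ∑ j, (N a j - ι (N' a j)) * N⁻¹ j b
            - ∑ j, ι (N' a j) * (N⁻¹ j b - ι (M' j b)) := by
        rw [← mul_nonsing_inv _ hN]
        simp only [mul_apply, map_sum, map_mul, NN, MM, of_apply]
        rw [← Finset.sum_sub_distrib, ← Finset.sum_neg_distrib, ← Finset.sum_sub_distrib]
        refine Finset.sum_congr rfl fun j _ => ?_
        ring
      rw [e]
      refine (F 1).sub_mem ((F 1).neg_mem ((F 1).sum_mem fun j _ => ?_)) ((F 1).sum_mem fun j _ => ?_)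
      · exact hmono _ _ (by omega) (hmul _ _ _ _ (hN' a j) (hK2 (j, b)))
      · exact hmono _ _ (by omega) (hmul _ _ _ _ (hK3 (a, j)) (hM' j b))
    -- determinant is congruent to one
    have hdet : ∀ Z : Matrix (Fin n) (Fin n) L,
        (∀ a b, Z a b - (1 : Matrix (Fin n) (Fin n) L) a b ∈ F 1) → Z.det - 1 ∈ F 1 := by
      intro Z hZ
      let O : Subring L :=
        { carrier := F 0
          mul_mem' := fun {x y} hx hy => by simpa using hmul 0 0 x y hx hy
          one_mem' := hone
          add_mem' := fun hx hy => (F 0).add_mem hx hy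
          zero_mem' := (F 0).zero_mem
          neg_mem' := fun hx => (F 0).neg_mem hx }
      let I : Ideal O :=
        { carrier := {x | (x : L) ∈ F 1}
          add_mem' := fun hx hy => (F 1).add_mem hx hy
          zero_mem' := (F 1).zero_mem
          smul_mem' := fun c x hx => by
            have := hmul 0 1 c x c.2 hx
            simpa using this }
      have hO : ∀ a b, Z a b ∈ O := by
        intro a b
        have h1 : (1 : Matrix (Fin n) (Fin n) L) a b ∈ F 0 := by
          rw [Matrix.one_apply]; split_ifs
          · exact hone
          · exact (F 0).zero_mem
        have := (F 0).add_mem (hmono 0 1 (by norm_num) (hZ a b)) h1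
        have h2 : Z a b ∈ F 0 := by simpa using this
        exact h2
      let Z' : Matrix (Fin n) (Fin n) O := Matrix.of fun a b => ⟨Z a b, hO a b⟩
      have hZ' : Z.det = (Z'.det : L) := by
        have : Z = Z'.map O.subtype := by ext a b; rfl
        rw [this]
        exact (RingHom.map_det O.subtype Z').symm
      have h1 : Z'.map (Ideal.Quotient.mk I) = 1 := by
        ext a b
        have : (1 : Matrix (Fin n) (Fin n) (O ⧸ I)) a b
          = Ideal.Quotient.mk I ((1 : Matrix (Fin n) (Fin n) O) a b) := by
          simp [Matrix.one_apply, apply_ite (Ideal.Quotient.mk I)]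
        rw [this, Matrix.map_apply, Ideal.Quotient.mk_eq_mk_iff_sub_mem]
        have := hZ a b
        have e : (((Z' a b - (1 : Matrix (Fin n) (Fin n) O) a b : O)) : L)
          = Z a b - (1 : Matrix (Fin n) (Fin n) L) a b := by
          simp [Matrix.one_apply, Z']
          split_ifs <;> simp
        change ((Z' a b - (1 : Matrix (Fin n) (Fin n) O) a b : O) : L) ∈ F 1
        rw [e]; exact this
      have h2 : Z'.det - 1 ∈ I := by
        rw [← Ideal.Quotient.mk_eq_mk_iff_sub_mem, map_one]
        rw [RingHom.map_det]
        have : (Ideal.Quotient.mk I).mapMatrix Z' = 1 := h1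
        rw [this, det_one]
      rw [hZ']
      exact h2
    have hdetNM : IsUnit (NN * MM).det := by
      apply hunitB
      rw [RingHom.map_det]
      apply hdet
      intro a b
      exact hprod a b
    rw [det_mul] at hdetNM
    have hdetN : IsUnit NN.det := isUnit_of_mul_isUnit_left hdetNM
    refine Compl.of_mul hdetN (Compl.of_isUnit_apply (i := i) (hunitB _ ?_))
    have e : ι ((v ᵥ* NN) i) - 1 = - ∑ a, ι (v a) * (N a i - ι (N' a i)) := by
      have := congrFun hi i
      simp only [Pi.single_eq_same] at this
      rw [← this]
      simp only [vecMul, dotProduct, map_sum, map_mul, NN, of_apply]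
      rw [← Finset.sum_sub_distrib, ← Finset.sum_neg_distrib]
      refine Finset.sum_congr rfl fun j _ => ?_
      ring
    rw [e]
    refine (F 1).neg_mem ((F 1).sum_mem fun j _ => ?_)
    exact hmono _ _ (by omega) (hmul _ _ _ _ (hK1 j) (hN' j i))


section horrocks

lemma exists_coprime_relation {D : Type} [CommRing D] [IsDomain D] [IsPrincipalIdealRing D]
    (x y : D) : ∃ α β s t : D, α * x + β * y = 0 ∧ α * s + β * t = 1 := by
  by_cases hy : y = 0
  · exact ⟨0, 1, 0, 1, by simp [hy], by simp⟩
  obtain ⟨g, hg⟩ := IsPrincipalIdealRing.principal (Ideal.span {x, y})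
  have hx' : x ∈ Ideal.span {g} := by
    rw [Ideal.span, ← hg]; exact Ideal.subset_span (by simp)
  have hy' : y ∈ Ideal.span {g} := by
    rw [Ideal.span, ← hg]; exact Ideal.subset_span (by simp)
  have hg' : g ∈ Ideal.span {x, y} := by
    rw [hg]; exact Ideal.subset_span (by simp)
  rw [Ideal.mem_span_singleton] at hx' hy'
  obtain ⟨a, rfl⟩ := hx'
  obtain ⟨b, rfl⟩ := hy'
  obtain ⟨s, t, hst⟩ := Ideal.mem_span_pair.1 hg'
  have hg0 : g ≠ 0 := by rintro rfl; simp at hy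
  refine ⟨b, -a, t, -s, by ring, ?_⟩
  apply mul_left_cancel₀ hg0
  rw [mul_one]
  conv_rhs => rw [← hst]
  ring

/-- In the kernel of a split surjection of corank at least two over a PID, every vector is killed
by some unimodular functional. -/
lemma exists_transversal {D : Type} [CommRing D] [IsDomain D] [IsPrincipalIdealRing D]
    {m n : Type} [Fintype m] [Fintype n] [DecidableEq m] [DecidableEq n]
    (V : Matrix m n D) (W : Matrix n m D) (hVW : V * W = 1)
    (hcard : Fintype.card m + 2 ≤ Fintype.card n) (x : n → D) (hx : V *ᵥ x = 0) :
    ∃ q φ : n → D, V *ᵥ q = 0 ∧ φ ⬝ᵥ q = 1 ∧ φ ⬝ᵥ x = 0 := by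
  let P := LinearMap.ker V.mulVecLin
  have hsurj : Function.Surjective V.mulVecLin := fun y =>
    ⟨W *ᵥ y, by simp [mulVec_mulVec, hVW]⟩
  have hrank : Module.finrank D P + Fintype.card m = Fintype.card n := by
    have := Submodule.finrank_quotient_add_finrank P
    rw [(LinearMap.quotKerEquivOfSurjective _ hsurj).finrank_eq] at this
    simp only [Module.finrank_fintype_fun_eq_card] at this
    rw [add_comm]; exact this
  let b := Module.finBasis D P
  obtain ⟨k, hk⟩ : ∃ k, Module.finrank D P = k + 2 := ⟨Module.finrank D P - 2, by omega⟩
  obtain ⟨b⟩ : Nonempty (Module.Basis (Fin (k + 2)) D P) := ⟨b.reindex (finCongr hk)⟩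
  let x' : P := ⟨x, hx⟩
  obtain ⟨α, β, s, t, h1, h2⟩ := exists_coprime_relation (b.repr x' 0) (b.repr x' 1)
  let E : (n → D) →ₗ[D] P := LinearMap.codRestrict P (LinearMap.id - W.mulVecLin ∘ₗ V.mulVecLin)
    (by intro c; simp [P, mulVec_sub, mulVec_mulVec, ← Matrix.mul_assoc, hVW])
  have hE : ∀ p : P, E p = p := by
    rintro ⟨p, hp⟩
    have hp' : V *ᵥ p = 0 := hp
    ext1
    simp [E, hp', ← mulVec_mulVec]
  let ψ : P →ₗ[D] D := α • b.coord 0 + β • b.coord 1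
  let f : (n → D) →ₗ[D] D := ψ ∘ₗ E
  let q : P := s • b 0 + t • b 1
  have hf : ∀ c, (fun i => f (Pi.single i 1)) ⬝ᵥ c = f c := by
    intro c
    conv_rhs => rw [pi_eq_sum_univ' c]
    simp only [map_sum, map_smul, smul_eq_mul, dotProduct]
    refine Finset.sum_congr rfl fun i _ => ?_
    rw [mul_comm]
  refine ⟨q, fun i => f (Pi.single i 1), q.2, ?_, ?_⟩
  · rw [hf]
    change ψ (E q) = 1
    rw [hE]
    simp [ψ, q, h2]
  · rw [hf]
    change ψ (E x') = 0
    rw [hE]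
    simpa [ψ] using h1

/-- Splitting a vector with a unit coordinate off a free module. -/
lemma split_off {B : Type} [CommRing B] {n : Type} [Fintype n] [DecidableEq n] {k : ℕ}
    (E : Matrix n n B) (U : Matrix (Fin (k+1)) n B) (X : Matrix n (Fin (k+1)) B)
    (hUX : U * X = 1) (hXU : X * U = E) (p φ : n → B) (hp : E *ᵥ p = p) (hφ : φ ᵥ* E = φ)
    (hφp : φ ⬝ᵥ p = 1) (hunit : IsUnit ((U *ᵥ p) 0)) :
    ∃ (U' : Matrix (Fin k) n B) (X' : Matrix n (Fin k) B),
      U' * X' = 1 ∧ X' * U' = E - vecMulVec p φ := by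
  obtain ⟨c, hc⟩ := hunit.exists_left_inv
  set a : Fin (k+1) → B := U *ᵥ p with ha
  set f : Fin (k+1) → B := φ ᵥ* X with hf
  have hfa : f ⬝ᵥ a = 1 := by
    rw [hf, ha, dotProduct_mulVec, vecMul_vecMul, hXU, hφ, hφp]
  have hXa : X *ᵥ a = p := by rw [ha, mulVec_mulVec, hXU, hp]
  have hfU : f ᵥ* U = φ := by rw [hf, vecMul_vecMul, hXU, hφ]
  -- incl and projection
  let J : Matrix (Fin (k+1)) (Fin k) B := (1 : Matrix (Fin (k+1)) (Fin (k+1)) B).submatrix id Fin.succ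
  let Q : Matrix (Fin k) (Fin (k+1)) B :=
    (1 - vecMulVec (c • a) (Pi.single 0 1)).submatrix Fin.succ id
  have hQa : Q *ᵥ a = 0 := by
    have : Q *ᵥ a = fun i => ((1 - vecMulVec (c • a) (Pi.single 0 1)) *ᵥ a) (Fin.succ i) := rfl
    rw [this]
    ext i
    rw [sub_mulVec, one_mulVec, vecMulVec_mulVec]
    simp
    linear_combination (-(a i.succ)) * hc
  have hQJ : Q * J = 1 := by
    ext i j
    simp only [Q, J, mul_apply, submatrix_apply, id, Matrix.sub_apply, vecMulVec_apply]
    rw [Fin.sum_univ_succ]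
    simp [Matrix.one_apply, Fin.succ_ne_zero, (Fin.succ_ne_zero _).symm]
  have hJQ : J * Q = 1 - vecMulVec (c • a) (Pi.single 0 1) := by
    ext i j
    refine Fin.cases ?_ (fun i => ?_) i
    · have hs : (J * Q) 0 j = 0 := by
        rw [mul_apply]
        refine Finset.sum_eq_zero fun x _ => ?_
        have h0 : J 0 x = 0 := by
          simp only [J, submatrix_apply, id_eq]
          exact one_apply_ne (Fin.succ_ne_zero x).symm
        rw [h0, zero_mul]
      rw [hs]
      simp only [Matrix.sub_apply, vecMulVec_apply,
        Pi.smul_apply, smul_eq_mul, hc, one_mul]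
      by_cases hj : j = 0
      · subst hj; simp
      · simp [Matrix.one_apply, hj, Ne.symm hj]
    · simp [Q, J, mul_apply, Matrix.one_apply]
  refine ⟨Q * U, X * ((1 - vecMulVec a f) * J), ?_, ?_⟩
  · calc Q * U * (X * ((1 - vecMulVec a f) * J)) = Q * (U * X) * (1 - vecMulVec a f) * J := by
          simp only [Matrix.mul_assoc]
      _ = 1 := by
          rw [hUX, Matrix.mul_one, Matrix.mul_sub, mul_vecMulVec, hQa]
          simp [hQJ]
  · calc X * ((1 - vecMulVec a f) * J) * (Q * U) = X * ((1 - vecMulVec a f) * (J * Q)) * U := by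
          simp only [Matrix.mul_assoc]
      _ = X * (1 - vecMulVec a f) * U := by
          rw [hJQ]
          congr 2
          rw [Matrix.mul_sub, Matrix.mul_one, mul_vecMulVec, sub_mulVec, vecMulVec_mulVec,
            dotProduct_smul, hfa]
          simp
      _ = E - vecMulVec p φ := by
          rw [Matrix.mul_sub, Matrix.sub_mul, Matrix.mul_one, hXU, mul_vecMulVec, vecMulVec_mul,
            hXa, hfU]

lemma kernel_facts {B : Type} [CommRing B] {m n : Type} {k : ℕ} [Fintype m]
    [Fintype n] [DecidableEq m] [DecidableEq n] (V : Matrix m n B) (W : Matrix n m B)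
    (hVWB : V * W = 1) (U : Matrix (Fin k) n B) (X : Matrix n (Fin k) B) (hUX : U * X = 1)
    (hXU : X * U = 1 - W * V) : V * X = 0 ∧ U * W = 0 := by
  have hVX : V * X = 0 := by
    have h0 : V * X * U = 0 := by
      rw [Matrix.mul_assoc, hXU, Matrix.mul_sub, ← Matrix.mul_assoc, hVWB]; simp
    rw [← Matrix.mul_one (V * X), ← hUX, ← Matrix.mul_assoc, h0, Matrix.zero_mul]
  have hUW : U * W = 0 := by
    have h0 : X * (U * W) = 0 := by
      rw [← Matrix.mul_assoc, hXU, Matrix.sub_mul, Matrix.mul_assoc, hVWB]; simp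
    rw [← Matrix.one_mul (U * W), ← hUX, Matrix.mul_assoc, h0, Matrix.mul_zero]
  exact ⟨hVX, hUW⟩

lemma kernel_card {B : Type} [CommRing B] [Nontrivial B] {m n : Type} {k : ℕ} [Fintype m]
    [Fintype n] [DecidableEq m] [DecidableEq n] (V : Matrix m n B) (W : Matrix n m B)
    (hVWB : V * W = 1) (U : Matrix (Fin k) n B) (X : Matrix n (Fin k) B) (hUX : U * X = 1)
    (hXU : X * U = 1 - W * V) : Fintype.card n = Fintype.card (m ⊕ Fin k) := by
  obtain ⟨hVX, hUW⟩ := kernel_facts V W hVWB U X hUX hXU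
  let e : (n → B) ≃ₗ[B] (m ⊕ Fin k → B) := LinearEquiv.ofLinearMap
    (fromRows V U).mulVecLin (fromCols W X).mulVecLin
    (by
      rw [← mulVecLin_mul, fromRows_mul_fromCols, hVWB, hVX, hUW, hUX, fromBlocks_one,
        mulVecLin_one])
    (by
      rw [← mulVecLin_mul, fromCols_mul_fromRows, hXU, add_sub_cancel, mulVecLin_one])
  have := e.finrank_eq
  simpa using this

lemma rank_one_case {A B : Type} [CommRing A] [CommRing B] [Nontrivial B] (ψ : A →+* B)
    (hψ : Function.Injective ψ) {m n : Type} [Fintype m] [Fintype n] [DecidableEq m] [DecidableEq n]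
    (V : Matrix m n A) (W : Matrix n m A) (hVW : V * W = 1)
    (U : Matrix (Fin 1) n B) (X : Matrix n (Fin 1) B) (hUX : U * X = 1)
    (hXU : X * U = 1 - (W * V).map ψ) :
    ∃ (U' : Matrix (Fin 1) n A) (X' : Matrix n (Fin 1) A), U' * X' = 1 ∧ X' * U' = 1 - W * V := by
  have hVWB : V.map ψ * W.map ψ = 1 := by rw [← Matrix.map_mul, hVW]; simp
  rw [Matrix.map_mul] at hXU
  obtain ⟨hVX, hUW⟩ := kernel_facts _ _ hVWB U X hUX hXU
  have hcard := kernel_card _ _ hVWB U X hUX hXU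
  obtain ⟨e⟩ : Nonempty (n ≃ m ⊕ Fin 1) := Fintype.card_eq.1 hcard
  -- square matrices
  let MB : Matrix n n B := (fromRows (V.map ψ) U).submatrix e id
  let NB : Matrix n n B := (fromCols (W.map ψ) X).submatrix id e
  have hMN : MB * NB = 1 := by
    simp only [MB, NB]
    rw [← submatrix_mul _ _ _ id _ Function.bijective_id,
      fromRows_mul_fromCols, hVWB, hVX, hUW, hUX, fromBlocks_one, submatrix_one _ e.injective]
  have hdd : MB.det * NB.det = 1 := by rw [← det_mul, hMN, det_one]
  -- candidate vectors
  let p : n → A := fun i => ((fromRows V (Matrix.of fun _ : Fin 1 => Pi.single i 1)).submatrix e id).det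
  let φ : n → A := fun i => ((fromCols W (Matrix.of fun a (_ : Fin 1) => (Pi.single i 1 : n → A) a)).submatrix id e).det
  have hp : ∀ i, ψ (p i) = MB.det * X i 0 := by
    intro i
    have h1 : ψ (p i) = ((fromRows (V.map ψ)
        (Matrix.of fun _ : Fin 1 => Pi.single i (1 : B))).submatrix e id).det := by
      simp only [p]
      rw [RingHom.map_det]
      congr 1
      ext a b
      simp only [RingHom.mapMatrix_apply, Matrix.map_apply, submatrix_apply]
      rcases e a with a | a
      · simp
      · simp [Pi.single_apply, apply_ite ψ]
    have h2 : ((fromRows (V.map ψ)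
        (Matrix.of fun _ : Fin 1 => Pi.single i (1 : B))).submatrix e id).det * NB.det = X i 0 := by
      rw [← det_mul]
      simp only [NB]
      rw [← submatrix_mul _ _ _ id _ Function.bijective_id, fromRows_mul_fromCols, hVWB, hVX,
        det_submatrix_equiv_self, det_fromBlocks_one₁₁]
      simp [mul_apply, Pi.single_apply]
    rw [h1, ← h2]
    linear_combination (-((fromRows (V.map ψ)
        (Matrix.of fun _ : Fin 1 => Pi.single i (1 : B))).submatrix e id).det) * hdd
  have hφ : ∀ i, ψ (φ i) = NB.det * U 0 i := by
    intro i
    have h1 : ψ (φ i) = ((fromCols (W.map ψ)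
        (Matrix.of fun a (_ : Fin 1) => (Pi.single i 1 : n → B) a)).submatrix id e).det := by
      simp only [φ]
      rw [RingHom.map_det]
      congr 1
      ext a b
      simp only [RingHom.mapMatrix_apply, Matrix.map_apply, submatrix_apply]
      rcases e b with b | b
      · simp
      · simp [Pi.single_apply, apply_ite ψ]
    have h2 : MB.det * ((fromCols (W.map ψ)
        (Matrix.of fun a (_ : Fin 1) => (Pi.single i 1 : n → B) a)).submatrix id e).det = U 0 i := by
      rw [← det_mul]
      simp only [MB]
      rw [← submatrix_mul _ _ _ id _ Function.bijective_id, fromRows_mul_fromCols, hVWB, hUW,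
        det_submatrix_equiv_self, det_fromBlocks_one₁₁]
      simp [mul_apply, Pi.single_apply]
    rw [h1, ← h2]
    linear_combination (-((fromCols (W.map ψ)
        (Matrix.of fun a (_ : Fin 1) => (Pi.single i 1 : n → B) a)).submatrix id e).det) * hdd
  have hmap : ∀ (a b : Type) (Y Z : Matrix a b A), Y.map ψ = Z.map ψ → Y = Z := by
    intro a b Y Z h
    ext i j
    exact hψ (congrFun (congrFun h i) j)
  refine ⟨Matrix.of fun _ => φ, Matrix.of fun i _ => p i, ?_, ?_⟩
  · apply hmap
    rw [Matrix.map_mul]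
    ext i j
    have h1 : (U * X) 0 0 = 1 := by rw [hUX]; simp
    rw [mul_apply] at h1
    have hi : i = 0 := Subsingleton.elim _ _
    have hj : j = 0 := Subsingleton.elim _ _
    subst hi; subst hj
    simp only [mul_apply, Matrix.map_apply, of_apply, hφ, hp, one_apply_eq, map_one]
    calc _ = MB.det * NB.det * ∑ j, U 0 j * X j 0 := by
            rw [Finset.mul_sum]; exact Finset.sum_congr rfl fun j _ => by ring
      _ = 1 := by rw [h1, hdd, one_mul]
  · apply hmap
    have : (1 - W * V).map ψ = X * U := by
      rw [hXU, Matrix.map_sub _ (map_sub ψ), Matrix.map_mul]; simp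
    rw [this, Matrix.map_mul]
    ext i j
    simp only [mul_apply, Matrix.map_apply, of_apply, hφ, hp]
    simp
    linear_combination (X i 0 * U 0 j) * hdd

/-- Abstract form of the Horrocks-type descent. -/
theorem horrocks_abs {A D B J : Type} [CommRing A] [CommRing D] [IsDomain D]
    [IsPrincipalIdealRing D] [CommRing B] [Nontrivial B] (ψ : J → A →+* B) (π : A →+* D)
    (hπ : Function.Surjective π) (j₀ : J) (hinj : Function.Injective (ψ j₀))
    (H2 : ∀ I : Ideal A, I.map π = ⊤ → (∀ j, I.map (ψ j) = ⊤) → I = ⊤)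
    (H3 : ∀ (n : Type) [Fintype n] (u x : J → n → B), (∀ j, u j ⬝ᵥ x j = 1) →
      ∃ y : n → A, ∀ j, IsUnit (u j ⬝ᵥ fun i => ψ j (y i)))
    (H4 : ∀ b : J → B, ∃ h : A, ∀ j, IsUnit (ψ j h + b j))
    (k : ℕ) : ∀ (m n : Type) [Fintype m] [Fintype n] [DecidableEq m] [DecidableEq n]
    (V : Matrix m n A) (W : Matrix n m A) (_ : V * W = 1)
    (_ : ∀ j, ∃ (U : Matrix (Fin k) n B) (X : Matrix n (Fin k) B),
      U * X = 1 ∧ X * U = 1 - (W * V).map (ψ j)),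
    ∃ (k : ℕ) (U : Matrix (Fin k) n A) (X : Matrix n (Fin k) A),
      U * X = 1 ∧ X * U = 1 - W * V := by
  induction k with
  | zero =>
    intro m n _ _ _ _ V W hVW h
    obtain ⟨U, X, hUX, hXU⟩ := h j₀
    refine ⟨0, 0, 0, Subsingleton.elim _ _, ?_⟩
    have h0 : X * U = 0 := by ext i j; simp [mul_apply]
    rw [h0] at hXU
    rw [Matrix.zero_mul]
    ext i j
    apply hinj
    have := congrFun (congrFun hXU i) j
    rw [Matrix.zero_apply] at this
    rw [Matrix.zero_apply, map_zero, this]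
    simp [Matrix.one_apply, apply_ite (ψ j₀), -Matrix.map_mul]
  | succ k ih =>
    intro m n _ _ _ _ V W hVW h
    obtain _ | k := k
    · obtain ⟨U, X, hUX, hXU⟩ := h j₀
      exact ⟨1, rank_one_case (ψ j₀) hinj V W hVW U X hUX hXU⟩
    have hmapE : ∀ j, (1 - W * V).map (ψ j) = 1 - (W * V).map (ψ j) := fun j => by
      rw [Matrix.map_sub _ (map_sub (ψ j))]; simp
    have hVWB : ∀ j, V.map (ψ j) * W.map (ψ j) = 1 := fun j => by
      rw [← Matrix.map_mul, hVW]; simp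
    have hcard : Fintype.card m + 2 ≤ Fintype.card n := by
      obtain ⟨U, X, hUX, hXU⟩ := h j₀
      rw [Matrix.map_mul] at hXU
      have := kernel_card _ _ (hVWB j₀) U X hUX hXU
      rw [this]
      simp
    choose U X hUX hXU using h
    set E := 1 - W * V with hE
    have hVE : V * E = 0 := by
      rw [hE, Matrix.mul_sub, ← Matrix.mul_assoc, hVW]; simp
    have hEW : E * W = 0 := by
      rw [hE, Matrix.sub_mul, Matrix.mul_assoc, hVW]; simp
    have hEE : E * E = E := by
      conv_lhs => rw [hE, Matrix.sub_mul, Matrix.mul_assoc, hVE]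
      rw [Matrix.mul_zero, sub_zero, Matrix.one_mul]
    have hUE : ∀ j, U j * E.map (ψ j) = U j := fun j => by
      rw [hmapE, ← hXU, ← Matrix.mul_assoc, hUX, Matrix.one_mul]
    have hmv : ∀ j (y : n → A) (Y : Matrix n n A),
        (fun i => ψ j ((Y *ᵥ y) i)) = Y.map (ψ j) *ᵥ (fun i => ψ j (y i)) := fun j y Y => by
      ext i; simp [mulVec, dotProduct]
    -- a vector with unit first coordinate
    obtain ⟨y, hy⟩ := H3 n (fun j => U j 0) (fun j i => X j i 0) (fun j => by
      have : (U j * X j) 0 0 = 1 := by rw [hUX]; simp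
      exact this)
    set x := E *ᵥ y with hx
    have hEx : E *ᵥ x = x := by rw [hx, mulVec_mulVec, hEE]
    have hux : ∀ j, IsUnit ((U j *ᵥ fun i => ψ j (x i)) 0) := fun j => by
      rw [hx, hmv, mulVec_mulVec, hUE]
      exact hy j
    -- reduction modulo the maximal ideal
    obtain ⟨q, φ, hq, hφq, hφx⟩ := exists_transversal (V.map π) (W.map π)
      (by rw [← Matrix.map_mul, hVW]; simp) hcard (fun i => π (x i)) (by
        have : V *ᵥ x = 0 := by rw [hx, mulVec_mulVec, hVE, zero_mulVec]
        ext i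
        have := congrArg π (congrFun this i)
        simpa [mulVec, dotProduct] using this)
    choose q₀ hq₀ using fun i => hπ (q i)
    set q₁ := E *ᵥ q₀ with hq₁
    have hq₁π : ∀ i, π (q₁ i) = q i := by
      have : (fun i => π (q₁ i)) = E.map π *ᵥ (fun i => π (q₀ i)) := by
        ext i; rw [hq₁, RingHom.map_mulVec]; rfl
      have h2 : (fun i => π (q₀ i)) = q := funext hq₀
      rw [h2, hE, Matrix.map_sub _ (map_sub π), Matrix.map_mul, sub_mulVec, ← mulVec_mulVec, hq]
        at this
      intro i
      have := congrFun this i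
      simpa using this
    choose c hc using fun j => (hux j).exists_left_inv
    obtain ⟨t, ht⟩ := H4 (fun j => c j * (U j *ᵥ fun i => ψ j (q₁ i)) 0)
    set p := q₁ + t • x with hp
    have hEp : E *ᵥ p = p := by
      rw [hp, mulVec_add, mulVec_smul, hEx, hq₁, mulVec_mulVec, hEE]
    have hup : ∀ j, IsUnit ((U j *ᵥ fun i => ψ j (p i)) 0) := fun j => by
      have e1 : (fun i => ψ j (p i)) = (fun i => ψ j (q₁ i)) + ψ j t • (fun i => ψ j (x i)) := by
        ext i; simp [hp]
      rw [e1, mulVec_add, mulVec_smul]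
      have e2 : ((U j *ᵥ fun i => ψ j (q₁ i)) + ψ j t • (U j *ᵥ fun i => ψ j (x i))) 0
          = (U j *ᵥ fun i => ψ j (x i)) 0 * (ψ j t + c j * (U j *ᵥ fun i => ψ j (q₁ i)) 0) := by
        simp only [Pi.add_apply, Pi.smul_apply, smul_eq_mul]
        linear_combination (-(U j *ᵥ fun i => ψ j (q₁ i)) 0) * hc j
      rw [e2]
      exact (hux j).mul (ht j)
    -- the ideal generated by p
    have hI : Ideal.span (Set.range p) = ⊤ := by
      have key : ∀ {C : Type} [CommRing C] (f : A →+* C) (r : n → C),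
          IsUnit (r ⬝ᵥ fun i => f (p i)) → (Ideal.span (Set.range p)).map f = ⊤ := by
        intro C _ f r hr
        refine Ideal.eq_top_of_isUnit_mem _ (Ideal.sum_mem _ fun i _ => ?_) hr
        exact Ideal.mul_mem_left _ _ (Ideal.mem_map_of_mem f (Ideal.subset_span ⟨i, rfl⟩))
      refine H2 _ (key π φ ?_) fun j => key (ψ j) (U j 0) (hup j)
      have e1 : (fun i => π (p i)) = q + π t • (fun i => π (x i)) := by
        ext i; simp [hp, hq₁π]
      rw [e1, dotProduct_add, dotProduct_smul, hφq, hφx]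
      simp
    obtain ⟨f₀, hf₀⟩ : ∃ f₀ : n → A, f₀ ⬝ᵥ p = 1 := by
      have h1 : (1 : A) ∈ Ideal.span (Set.range p) := by rw [hI]; trivial
      obtain ⟨f, hf⟩ := (Submodule.mem_span_range_iff_exists_fun A).1 h1
      exact ⟨f, hf⟩
    set f := f₀ ᵥ* E with hf
    have hfE : f ᵥ* E = f := by rw [hf, vecMul_vecMul, hEE]
    have hfp : f ⬝ᵥ p = 1 := by rw [hf, ← dotProduct_mulVec, hEp, hf₀]
    let V' : Matrix (m ⊕ Fin 1) n A := fromRows V (replicateRow (Fin 1) f)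
    let W' : Matrix n (m ⊕ Fin 1) A := fromCols W (replicateCol (Fin 1) p)
    have hpf : vecMulVec p f = replicateCol (Fin 1) p * replicateRow (Fin 1) f := by
      ext a b; simp [mul_apply, vecMulVec_apply]
    have hWV' : W' * V' = W * V + vecMulVec p f := by
      simp only [W', V']
      rw [fromCols_mul_fromRows, hpf]
    have hVW' : V' * W' = 1 := by
      simp only [W', V']
      rw [fromRows_mul_fromCols, hVW]
      have h1 : V * replicateCol (Fin 1) p = 0 := by
        rw [← hEp, replicateCol_mulVec, ← Matrix.mul_assoc, hVE, Matrix.zero_mul]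
      have h2 : replicateRow (Fin 1) f * W = 0 := by
        rw [← hfE, replicateRow_vecMul, Matrix.mul_assoc, hEW, Matrix.mul_zero]
      have h3 : replicateRow (Fin 1) f * replicateCol (Fin 1) p = 1 := by
        ext i j
        rw [Subsingleton.elim i j]
        have : (replicateRow (Fin 1) f * replicateCol (Fin 1) p) j j = f ⬝ᵥ p := rfl
        rw [this, hfp]; simp
      rw [h1, h2, h3, fromBlocks_one]
    obtain ⟨k', U', X', h1, h2⟩ := ih (m ⊕ Fin 1) n V' W' hVW' (fun j => by
      obtain ⟨U', X', h1, h2⟩ := split_off (E.map (ψ j)) (U j) (X j) (hUX j)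
        (by rw [hXU, hmapE]) (fun i => ψ j (p i)) (fun i => ψ j (f i))
        (by rw [← hmv, hEp])
        (by
          ext i
          have := congrArg (ψ j) (congrFun hfE i)
          rw [RingHom.map_vecMul] at this
          exact this)
        (by
          have := congrArg (ψ j) hfp
          simpa [dotProduct] using this)
        (hup j)
      refine ⟨U', X', h1, ?_⟩
      rw [h2, hWV', Matrix.map_add _ (map_add (ψ j)), hmapE, sub_sub]
      congr 2
      ext a b
      simp [vecMulVec_apply])
    -- add the vector back
    rw [hWV'] at h2
    have hE' : X' * U' = E - vecMulVec p f := by rw [h2, hE, sub_sub]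
    obtain ⟨hVX', hUW'⟩ := kernel_facts V' W' hVW' U' X' h1 (by rw [h2, hWV'])
    have hfX : replicateRow (Fin 1) f * X' = 0 := by
      have := congrArg (fun M => M.submatrix Sum.inr id) hVX'
      exact this
    have hUp : U' * replicateCol (Fin 1) p = 0 := by
      have := congrArg (fun M => M.submatrix id Sum.inr) hUW'
      exact this
    have hfp1 : replicateRow (Fin 1) f * replicateCol (Fin 1) p = 1 := by
      ext i j
      rw [Subsingleton.elim i j]
      have : (replicateRow (Fin 1) f * replicateCol (Fin 1) p) j j = f ⬝ᵥ p := rfl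
      rw [this, hfp]; simp
    refine ⟨k' + 1, (fromRows U' (replicateRow (Fin 1) f)).submatrix finSumFinEquiv.symm id,
      (fromCols X' (replicateCol (Fin 1) p)).submatrix id finSumFinEquiv.symm, ?_, ?_⟩
    · rw [← submatrix_mul _ _ _ id _ Function.bijective_id, fromRows_mul_fromCols, h1, hUp, hfX,
        hfp1, fromBlocks_one, submatrix_one _ (Equiv.injective _)]
    · rw [← submatrix_mul _ _ _ _ _ (Equiv.bijective _), fromCols_mul_fromRows, hE',
        ← hpf, sub_add_cancel]
      rfl

end horrocks

theorem kerH_of_abs {A D B J : Type} [CommRing A] [CommRing D] [IsDomain D]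
    [IsPrincipalIdealRing D] [CommRing B] [Nontrivial B] (ψ : J → A →+* B) (π : A →+* D)
    (hπ : Function.Surjective π) (j₀ : J) (hinj : Function.Injective (ψ j₀))
    (H2 : ∀ I : Ideal A, I.map π = ⊤ → (∀ j, I.map (ψ j) = ⊤) → I = ⊤)
    (H3 : ∀ (n : Type) [Fintype n] (u x : J → n → B), (∀ j, u j ⬝ᵥ x j = 1) →
      ∃ y : n → A, ∀ j, IsUnit (u j ⬝ᵥ fun i => ψ j (y i)))
    (H4 : ∀ b : J → B, ∃ h : A, ∀ j, IsUnit (ψ j h + b j))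
    (hB : RowH B) : KerH A := by
  intro n v w hvw
  have hW : (Matrix.of fun (i : Fin n) (_ : Fin 1) => w i) *
      (Matrix.of fun (_ : Fin 1) (i : Fin n) => v i) = vecMulVec w v := by
    ext i j; simp [Matrix.mul_apply, vecMulVec_apply]
  have := horrocks_abs ψ π hπ j₀ hinj H2 H3 H4 (n - 1) (Fin 1) (Fin n)
    (Matrix.of fun _ i => v i) (Matrix.of fun i _ => w i) ?_ ?_
  · rw [hW] at this
    exact this
  · ext i j
    have : i = j := Subsingleton.elim _ _
    subst this
    simpa [Matrix.mul_apply, dotProduct] using hvw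
  · intro j
    have h1 : (fun i => ψ j (v i)) ⬝ᵥ (fun i => ψ j (w i)) = 1 := by
      have := congrArg (ψ j) hvw
      simpa [dotProduct] using this
    obtain ⟨U, X, h2, h3⟩ := RowH.ker_aux h1 (hB _ _ _ h1)
    refine ⟨U, X, h2, ?_⟩
    rw [h3, hW]
    congr 1
    ext a b
    simp [vecMulVec_apply]

section H2
variable {R : Type} [CommRing R] [IsLocalRing R]

theorem ideal_eq_top_aux {A D : Type} [CommRing A] [CommRing D] (c : R →+* A) (π : A →+* D)
    (hπ : Function.Surjective π)
    (hker : RingHom.ker π ≤ (IsLocalRing.maximalIdeal R).map c)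
    (I : Ideal A) (hI : I.map π = ⊤)
    (hInt : ((Ideal.Quotient.mk I).comp c).IsIntegral) : I = ⊤ := by
  by_contra hne
  obtain ⟨M, hM, hIM⟩ := Ideal.exists_le_maximal I hne
  have hInt' : ((Ideal.Quotient.mk M).comp c).IsIntegral := by
    have : (Ideal.Quotient.mk M).comp c
        = (Ideal.Quotient.factor hIM).comp ((Ideal.Quotient.mk I).comp c) := by
      ext; simp
    rw [this]
    exact RingHom.IsIntegral.trans _ _ hInt
      (RingHom.isIntegral_of_surjective _ (Ideal.Quotient.factor_surjective hIM))
  have hmax : (Ideal.comap ((Ideal.Quotient.mk M).comp c) ⊥).IsMaximal := by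
    have : (⊥ : Ideal (A ⧸ M)).IsMaximal := by
      let _ := Ideal.Quotient.field M
      exact Ideal.bot_isMaximal
    exact Ideal.isMaximal_comap_of_isIntegral_of_isMaximal' _ hInt' _
  have hm := IsLocalRing.eq_maximalIdeal hmax
  have hle : (IsLocalRing.maximalIdeal R).map c ≤ M := by
    rw [Ideal.map_le_iff_le_comap, ← hm]
    intro x hx
    simpa [Ideal.mem_comap, Ideal.Quotient.eq_zero_iff_mem] using hx
  have h1 : (1 : D) ∈ I.map π := by rw [hI]; trivial
  obtain ⟨i, hi, hi1⟩ := (Ideal.mem_map_iff_of_surjective π hπ).1 h1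
  apply hM.ne_top
  rw [Ideal.eq_top_iff_one]
  have : (1 - i) ∈ M := hle (hker (by rw [RingHom.mem_ker]; simp [hi1]))
  have := M.add_mem this (hIM hi)
  simpa using this

theorem isIntegral_poly {A : Type} [CommRing A] (c : R →+* A) (x : A) (hx : c.IsIntegralElem x)
    (f : R[X]) : c.IsIntegralElem (Polynomial.eval₂ c x f) := by
  have hpow : ∀ n : ℕ, c.IsIntegralElem (x ^ n) := by
    intro n
    induction n with
    | zero => simpa using c.isIntegralElem_one
    | succ n ih => rw [pow_succ]; exact RingHom.IsIntegralElem.mul c ih hx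
  induction f using Polynomial.induction_on' with
  | add p q hp hq => rw [Polynomial.eval₂_add]; exact RingHom.IsIntegralElem.add c hp hq
  | monomial n a =>
    rw [Polynomial.eval₂_monomial]
    exact RingHom.IsIntegralElem.mul c (c.isIntegralElem_map) (hpow n)

theorem H2_poly (I : Ideal R[X]) (hI : I.map (mapRingHom (IsLocalRing.residue R)) = ⊤)
    (f : R[X]) (hf : f.Monic) (hfI : f ∈ I) : I = ⊤ := by
  refine ideal_eq_top_aux (C : R →+* R[X]) (mapRingHom (IsLocalRing.residue R))
    (Polynomial.map_surjective _ IsLocalRing.residue_surjective) ?_ I hI ?_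
  · rw [Polynomial.ker_mapRingHom, IsLocalRing.ker_residue]
  · have key : ∀ p : R[X], Polynomial.eval₂ ((Ideal.Quotient.mk I).comp C)
        (Ideal.Quotient.mk I X) p = Ideal.Quotient.mk I p := by
      intro p
      rw [← Polynomial.hom_eval₂, Polynomial.eval₂_C_X]
    intro y
    obtain ⟨p, rfl⟩ := Ideal.Quotient.mk_surjective y
    rw [← key]
    refine isIntegral_poly _ _ ⟨f, hf, ?_⟩ _
    rw [key]
    exact Ideal.Quotient.eq_zero_iff_mem.2 hfI

end H2

section Bfacts
variable {R : Type} [CommRing R] [Nontrivial R]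

noncomputable abbrev am (R : Type) [CommRing R] : R[X] →+* MonicLoc R := algebraMap R[X] (MonicLoc R)

theorem isUnit_am {f : R[X]} (hf : f.Monic) : IsUnit (am R f) :=
  IsLocalization.map_units (MonicLoc R) (⟨f, hf⟩ : monicSubmonoid R)

theorem am_injective : Function.Injective (am R) := by
  apply IsLocalization.injective (MonicLoc R) (M := monicSubmonoid R)
  intro f hf
  exact Polynomial.Monic.mem_nonZeroDivisors hf

instance nontrivial_monicLoc : Nontrivial (MonicLoc R) := am_injective.nontrivial

theorem exists_denom {ι : Type} [Finite ι] (x : ι → MonicLoc R) :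
    ∃ (g : R[X]) (a : ι → R[X]), g.Monic ∧ ∀ i, am R g * x i = am R (a i) := by
  obtain ⟨g, hg⟩ := IsLocalization.exist_integer_multiples_of_finite (monicSubmonoid R) x
  choose a ha using hg
  refine ⟨g, a, g.2, fun i => ?_⟩
  rw [ha i, Algebra.smul_def]

theorem isUnit_of_am_mul {g : R[X]} {a : R[X]} (ha : a.Monic) {x : MonicLoc R}
    (h : am R g * x = am R a) : IsUnit x := by
  have := isUnit_am ha
  rw [← h] at this
  exact isUnit_of_mul_isUnit_right this

theorem exists_monic_of_map_eq_top (I : Ideal R[X]) (h : I.map (am R) = ⊤) :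
    ∃ f ∈ I, f.Monic := by
  have h1 : (1 : MonicLoc R) ∈ I.map (am R) := by rw [h]; trivial
  obtain ⟨⟨a, s⟩, hs⟩ := (IsLocalization.mem_map_algebraMap_iff (monicSubmonoid R) _).1 h1
  have : am R (s : R[X]) = am R (a : R[X]) := by simpa using hs
  exact ⟨s, by rw [am_injective this]; exact a.2, s.2⟩

/-- growth lemma -/
theorem growth (c : MonicLoc R) (hc : IsUnit c) (y z : MonicLoc R) :
    ∃ N0 : ℕ, ∀ N ≥ N0, ∀ K : ℕ, ∀ s : MonicLoc R, am R X * s = 1 →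
      IsUnit (am R X ^ N * c + y + s ^ K * z) := by
  obtain ⟨d, hd⟩ := hc
  obtain ⟨g, a, hg, hga⟩ := exists_denom ![y * (↑d⁻¹ : MonicLoc R), z * (↑d⁻¹ : MonicLoc R)]
  have h0 := hga 0
  have h1 := hga 1
  simp only [Matrix.cons_val_zero, Matrix.cons_val_one] at h0 h1
  refine ⟨(a 0).natDegree + (a 1).natDegree + 1, fun N hN K s hs => ?_⟩
  have hm : (X ^ (N + K) * g + (X ^ K * a 0 + a 1)).Monic := by
    apply Polynomial.Monic.add_of_left ((Polynomial.monic_X_pow _).mul hg)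
    rw [degree_eq_natDegree ((Polynomial.monic_X_pow (N + K)).mul hg).ne_zero
      , (Polynomial.monic_X_pow (N + K)).natDegree_mul hg, natDegree_X_pow]
    refine lt_of_le_of_lt (degree_le_natDegree) ?_
    norm_cast
    have e1 : (X ^ K * a 0).natDegree ≤ K + (a 0).natDegree := by
      refine natDegree_mul_le.trans ?_
      simp
    have := natDegree_add_le (X ^ K * a 0) (a 1)
    have : max (X ^ K * a 0).natDegree (a 1).natDegree < N + K + g.natDegree := by
      apply max_lt <;> omega
    omega
  have hsK : am R X ^ K * s ^ K = 1 := by rw [← mul_pow, hs, one_pow]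
  have hdd : (d : MonicLoc R) * (↑d⁻¹ : MonicLoc R) = 1 := by simp
  have : IsUnit ((am R X ^ N * c + y + s ^ K * z) * (↑d⁻¹ : MonicLoc R)) := by
    refine isUnit_of_am_mul (g := X ^ K * g) hm ?_
    simp only [map_add, map_mul, map_pow, ← h0, ← h1, ← hd]
    linear_combination (am R X ^ (N + K) * am R g) * hdd + am R g * z * (↑d⁻¹ : MonicLoc R) * hsK
  exact isUnit_of_mul_isUnit_left this

end Bfacts

section poly
variable {R : Type} [CommRing R] [IsLocalRing R]

theorem rowH_poly_of_monicLoc (hB : RowH (MonicLoc R)) : RowH R[X] := by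
  rw [← isHermite_iff_rowH]
  apply KerH.isHermite
  refine kerH_of_abs (J := Unit) (fun _ => am R) (mapRingHom (IsLocalRing.residue R))
    (Polynomial.map_surjective _ IsLocalRing.residue_surjective) () am_injective ?_ ?_ ?_ hB
  · intro I h1 h2
    obtain ⟨f, hf, hfm⟩ := exists_monic_of_map_eq_top I (h2 ())
    exact H2_poly I h1 f hfm hf
  · intro n _ u x hux
    obtain ⟨g, a, hg, ha⟩ := exists_denom (x ())
    refine ⟨a, fun j => ?_⟩
    have : (fun i => am R (a i)) = am R g • x () := by
      ext i; simp [← ha]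
    rw [this, dotProduct_smul, hux]
    simpa using isUnit_am hg
  · intro b
    obtain ⟨N0, hN⟩ := growth (1 : MonicLoc R) isUnit_one (b ()) 0
    obtain ⟨s, hs⟩ := (isUnit_am (R := R) monic_X).exists_right_inv
    refine ⟨X ^ N0, fun j => ?_⟩
    have := hN N0 le_rfl 0 s hs
    simpa using this

/-- descent: from `R[X]`-algebras between `R[X]` and `R⟨X⟩`. -/
theorem rowH_monicLoc_of {A : Type} [CommRing A] (θ : R[X] →+* A) (φ : A →+* MonicLoc R)
    (hφ : φ.comp θ = am R) (hA : RowH A) : RowH (MonicLoc R) := by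
  classical
  intro n v0 w0 hvw0
  obtain ⟨g, a, hg, ha⟩ := exists_denom v0
  obtain ⟨h, w, hh, hw⟩ := exists_denom w0
  have hga : (fun i => am R (a i)) = am R g • v0 := by ext i; simp [← ha]
  have hhw : (fun i => am R (w i)) = am R h • w0 := by ext i; simp [← hw]
  have hf : a ⬝ᵥ w = g * h := by
    apply am_injective (R := R)
    have : am R (a ⬝ᵥ w) = (fun i => am R (a i)) ⬝ᵥ (fun i => am R (w i)) := by
      simp [dotProduct]
    rw [this, hga, hhw, smul_dotProduct, dotProduct_smul, hvw0]
    simp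
  apply Compl.of_smul (isUnit_am hg)
  rw [← hga]
  set π := mapRingHom (IsLocalRing.residue R) with hπ
  have hfm : (a ⬝ᵥ w).Monic := hf ▸ hg.mul hh
  -- some entry is nonzero mod m
  obtain ⟨i, hi⟩ : ∃ i, π (a i) ≠ 0 := by
    by_contra hcon
    push Not at hcon
    have h1 : π (a ⬝ᵥ w) = 0 := by simp [dotProduct, hcon]
    have h2 : (π (a ⬝ᵥ w)).Monic := hfm.map _
    rw [h1] at h2
    exact h2.ne_zero rfl
  by_cases hj : ∃ j, j ≠ i
  swap
  · push Not at hj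
    apply Compl.of_isUnit_apply (i := i)
    have : a ⬝ᵥ w = a i * w i := by
      rw [dotProduct]
      exact Finset.sum_eq_single i (fun b _ hb => absurd (hj b) hb) (by simp)
    have h3 := isUnit_am hfm
    rw [this, map_mul] at h3
    exact isUnit_of_mul_isUnit_left h3
  obtain ⟨j, hji⟩ := hj
  -- monic lift
  obtain ⟨G0, hG0, hG0m⟩ : ∃ G0 : R[X], π (a i) ∣ π G0 ∧ G0.Monic := by
    set p := π (a i)
    have hp : (p * C p.leadingCoeff⁻¹).Monic := monic_mul_leadingCoeff_inv hi
    have hl : p * C p.leadingCoeff⁻¹ ∈ Polynomial.lifts (IsLocalRing.residue R) := by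
      obtain ⟨q, hq⟩ := Polynomial.map_surjective _ (IsLocalRing.residue_surjective (R := R))
        (p * C p.leadingCoeff⁻¹)
      exact (Polynomial.mem_lifts _).2 ⟨q, hq⟩
    obtain ⟨q, hq, -, hqm⟩ := Polynomial.lifts_and_degree_eq_and_monic hl hp
    exact ⟨q, by rw [hπ, coe_mapRingHom, hq]; exact dvd_mul_right _ _, hqm⟩
  set G : R[X] := X ^ ((w j).natDegree + 1) * G0 with hG
  have hGm : G.Monic := (monic_X_pow _).mul hG0m
  have hGd : π (a i) ∣ π G := by
    rw [hG, map_mul]; exact dvd_mul_of_dvd_right hG0 _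
  set v' : Fin n → R[X] := G • a + Pi.single j 1 with hv'
  have hv'w : v' ⬝ᵥ w = G * (a ⬝ᵥ w) + w j := by
    rw [hv', add_dotProduct, smul_dotProduct]; simp
  have hmon : (v' ⬝ᵥ w).Monic := by
    rw [hv'w]
    apply (hGm.mul hfm).add_of_left
    rw [degree_eq_natDegree (hGm.mul hfm).ne_zero, hGm.natDegree_mul hfm, hG,
      (monic_X_pow _).natDegree_mul hG0m, natDegree_X_pow]
    refine lt_of_le_of_lt (degree_le_natDegree) ?_
    norm_cast
    omega
  have htop : Ideal.span (Set.range v') = ⊤ := by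
    have hmem : ∀ l, v' l ∈ Ideal.span (Set.range v') := fun l =>
      Ideal.subset_span ⟨l, rfl⟩
    refine H2_poly _ ?_ (v' ⬝ᵥ w) hmon ?_
    · rw [Ideal.eq_top_iff_one]
      have hi' := Ideal.mem_map_of_mem π (hmem i)
      have hj' := Ideal.mem_map_of_mem π (hmem j)
      have e1 : v' i = G * a i := by simp [hv', Pi.single_apply, hji.symm]
      have e2 : v' j = G * a j + 1 := by simp [hv']
      rw [e1, map_mul] at hi'
      rw [e2, map_add, map_mul, map_one] at hj'
      set J := Ideal.map π (Ideal.span (Set.range v'))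
      -- a_i divides G
      obtain ⟨q, hq⟩ := hGd
      have h4 : π G * π G * 1 ∈ J := by
        have := J.mul_mem_right q hi'
        convert this using 1
        linear_combination π G * hq
      -- 1 = (1 + G a_j)(1 - G a_j) + G^2 a_j^2
      have h5 := J.add_mem (J.mul_mem_right (1 - π G * π (a j)) hj')
        (J.mul_mem_right (π (a j) * π (a j)) h4)
      convert h5 using 1
      ring
    · rw [dotProduct]
      exact Ideal.sum_mem _ fun l _ => Ideal.mul_mem_right _ _ (hmem l)
  obtain ⟨x, hx⟩ : ∃ x : Fin n → R[X], v' ⬝ᵥ x = 1 := by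
    have : (1 : R[X]) ∈ Ideal.span (Set.range v') := by rw [htop]; trivial
    obtain ⟨c, hc⟩ := (Ideal.mem_span_range_iff_exists_fun).1 this
    exact ⟨c, by rw [← hc, dotProduct]; exact Finset.sum_congr rfl fun _ _ => mul_comm _ _⟩
  have hcA : Compl (fun l => θ (v' l)) := by
    refine hA n _ (fun l => θ (x l)) ?_
    have := congrArg θ hx
    simpa [dotProduct] using this
  have hcB : Compl (fun l => am R (v' l)) := by
    have := hcA.map φ
    rw [← hφ]; exact this
  obtain ⟨Gi, hGi⟩ := (isUnit_am hGm).exists_right_inv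
  obtain ⟨Fi, hFi⟩ := (isUnit_am hfm).exists_right_inv
  have hGiu : IsUnit Gi := IsUnit.of_mul_eq_one (am R G) (by rw [mul_comm]; exact hGi)
  have hFiu : IsUnit Fi := IsUnit.of_mul_eq_one (am R (a ⬝ᵥ w)) (by rw [mul_comm]; exact hFi)
  have ham : (fun l => am R (a l)) ⬝ᵥ (fun l => am R (w l)) = am R (a ⬝ᵥ w) := by
    simp [dotProduct]
  refine Compl.of_add (w := Fi • fun l => am R (w l)) (u := Gi • Pi.single j 1) ?_ ?_ ?_
  · rw [dotProduct_smul, ham, smul_eq_mul, mul_comm, hFi]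
  · have : 1 + (Gi • Pi.single j (1 : MonicLoc R)) ⬝ᵥ (Fi • fun l => am R (w l))
        = Gi * Fi * am R (v' ⬝ᵥ w) := by
      rw [hv'w, smul_dotProduct, dotProduct_smul, single_dotProduct]
      simp only [smul_eq_mul, map_add, map_mul, one_mul]
      linear_combination (-1 : MonicLoc R) * hGi * (am R (a ⬝ᵥ w) * Fi) - hFi
    rw [this]
    exact (hGiu.mul hFiu).mul (isUnit_am hmon)
  · apply Compl.of_smul (isUnit_am hGm)
    convert hcB using 1
    ext l
    simp only [hv', Pi.smul_apply, Pi.add_apply, smul_eq_mul, map_add, map_mul, Pi.single_apply]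
    split_ifs
    · simp only [map_one]; linear_combination hGi
    · simp

end poly

section series
variable {R : Type} [CommRing R] [Nontrivial R]

/-- `X ↦ s⁻¹` -/
noncomputable def iota0 (R : Type) [CommRing R] : R[X] →+* LaurentSeries R :=
  eval₂RingHom (HahnSeries.C (Γ := ℤ) (R := R)) (HahnSeries.single (-1 : ℤ) (1 : R))

theorem single_pow' (m : ℕ) (a : ℤ) :
    (HahnSeries.single a (1 : R) : LaurentSeries R) ^ m = HahnSeries.single (m * a) 1 := by
  rw [HahnSeries.single_pow]; simp

theorem iota0_coeff (f : R[X]) (n : ℤ) :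
    (iota0 R f).coeff n = if n ≤ 0 then f.coeff (-n).toNat else 0 := by
  induction f using Polynomial.induction_on' with
  | add p q hp hq => 
    rw [map_add, HahnSeries.coeff_add, hp, hq]
    split_ifs <;> simp
  | monomial m a =>
    rw [iota0, coe_eval₂RingHom, eval₂_monomial, single_pow', HahnSeries.C_apply,
      HahnSeries.single_mul_single, HahnSeries.coeff_single, coeff_monomial]
    split_ifs <;> first | omega | simp

/-- the filtration -/
def Filt (R : Type) [CommRing R] (N : ℤ) : AddSubgroup (LaurentSeries R) where
  carrier := {x | ∀ n < N, x.coeff n = 0}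
  zero_mem' := by intro n _; simp
  add_mem' := by
    intro x y hx hy n hn
    rw [HahnSeries.coeff_add, hx n hn, hy n hn, add_zero]
  neg_mem' := by
    intro x hx n hn
    rw [HahnSeries.coeff_neg, hx n hn, neg_zero]

theorem mem_Filt {N : ℤ} {x : LaurentSeries R} : x ∈ Filt R N ↔ ∀ n < N, x.coeff n = 0 := Iff.rfl

theorem Filt_mul (a b : ℤ) (x y : LaurentSeries R) (hx : x ∈ Filt R a) (hy : y ∈ Filt R b) :
    x * y ∈ Filt R (a + b) := by
  intro n hn
  rw [HahnSeries.coeff_mul]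
  apply Finset.sum_eq_zero
  rintro ⟨i, j⟩ hij
  rw [Finset.mem_addAntidiagonal] at hij
  have hij' : i + j = n := hij.2.2
  rcases lt_or_ge i a with h | h
  · simp [hx i h]
  · simp [hy j (by omega)]

theorem Filt_unit (x : LaurentSeries R) (hx : x - 1 ∈ Filt R 1) : IsUnit x := by
  apply HahnSeries.isUnit_of_orderTop_pos
  by_cases h : x - 1 = 0
  · rw [h]; simp
  · rw [HahnSeries.orderTop_of_ne_zero h]
    by_contra hcon
    have hc : ((x-1).isWF_support.min (HahnSeries.support_nonempty_iff.2 h)) ≤ 0 := by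
      simpa using hcon
    have := (x-1).isWF_support.min_mem (HahnSeries.support_nonempty_iff.2 h)
    exact this (hx _ (by omega))

theorem iota0_mem (f : R[X]) : iota0 R f ∈ Filt R (-(f.natDegree : ℤ)) := by
  intro n hn
  rw [iota0_coeff]
  split_ifs
  · apply coeff_eq_zero_of_natDegree_lt; omega
  · rfl

theorem iota0_isUnit (f : R[X]) (hf : f.Monic) : IsUnit (iota0 R f) := by
  apply isUnit_of_mul_isUnit_right (x := (HahnSeries.single (f.natDegree : ℤ) (1 : R)))
  apply Filt_unit
  intro n hn
  rw [HahnSeries.coeff_sub, HahnSeries.coeff_single_mul, iota0_coeff, HahnSeries.coeff_one, one_mul]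
  split_ifs with h1 h2 h2
  · subst h2; simp [hf]
  · rw [coeff_eq_zero_of_natDegree_lt (by omega)]; simp
  · omega
  · simp

noncomputable def iota (R : Type) [CommRing R] [Nontrivial R] : MonicLoc R →+* LaurentSeries R :=
  IsLocalization.lift (M := monicSubmonoid R) (g := iota0 R) (fun f => iota0_isUnit f.1 f.2)

theorem iota_am (f : R[X]) : iota R (am R f) = iota0 R f := IsLocalization.lift_eq _ _

theorem exists_single (n : ℤ) (r : R) : ∃ b, iota R b = HahnSeries.single n r := by
  have hX : iota R (am R X) = HahnSeries.single (-1 : ℤ) (1 : R) := by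
    rw [iota_am, iota0]; simp
  have hC : iota R (am R (C r)) = HahnSeries.C r := by
    rw [iota_am, iota0]; simp
  obtain ⟨s, hs⟩ := (isUnit_am (R := R) monic_X).exists_right_inv
  have hs' : iota R s = HahnSeries.single (1 : ℤ) (1 : R) := by
    have h1 := congrArg (iota R) hs
    rw [map_mul, hX, (iota R).map_one] at h1
    have h2 : (HahnSeries.single (1 : ℤ) (1 : R)) * (HahnSeries.single (-1 : ℤ) (1 : R))
      = (1 : LaurentSeries R) := by rw [HahnSeries.single_mul_single]; simp
    calc iota R s = (1 : LaurentSeries R) * iota R s := (one_mul _).symm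
      _ = _ := by rw [← h2]; rw [mul_assoc, h1, mul_one]
  rcases le_total 0 n with h | h
  · obtain ⟨m, rfl⟩ := Int.eq_ofNat_of_zero_le h
    refine ⟨am R (C r) * s ^ m, ?_⟩
    rw [map_mul, hC, map_pow, hs', single_pow', HahnSeries.C_apply, HahnSeries.single_mul_single]
    simp
  · obtain ⟨m, hm⟩ := Int.eq_ofNat_of_zero_le (neg_nonneg.2 h)
    obtain rfl : n = -(m : ℤ) := by omega
    refine ⟨am R (C r) * am R X ^ m, ?_⟩
    rw [map_mul, hC, map_pow, hX, single_pow', HahnSeries.C_apply, HahnSeries.single_mul_single]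
    simp

theorem rowH_series_iff : RowH (MonicLoc R) ↔ RowH (LaurentSeries R) := by
  have hex : ∀ x : LaurentSeries R, ∃ N : ℕ, x ∈ Filt R (-(N : ℤ)) := by
    intro x
    refine ⟨x.order.natAbs, fun n hn => HahnSeries.coeff_eq_zero_of_lt_order ?_⟩
    omega
  have hmono : ∀ a b, a ≤ b → Filt R b ≤ Filt R a := fun a b hab x hx n hn =>
    hx n (by omega)
  refine rowH_iff_of_filtration (iota R) (Filt R) hmono Filt_mul ?_ hex ?_ Filt_unit ?_
  · intro n hn
    rw [HahnSeries.coeff_one, if_neg (by omega)]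
  · intro x N
    have key : ∀ (k : ℕ) (x : LaurentSeries R), x ∈ Filt R (N - k) →
        ∃ b, x - iota R b ∈ Filt R N := by
      intro k
      induction k with
      | zero => intro x hx; exact ⟨0, by simpa using hx⟩
      | succ k ih =>
        intro x hx
        obtain ⟨b, hb⟩ := exists_single (N - (k + 1 : ℕ)) (x.coeff (N - (k + 1 : ℕ)))
        obtain ⟨c, hc⟩ := ih (x - iota R b) (by
          intro n hn
          rw [hb, HahnSeries.coeff_sub, HahnSeries.coeff_single]
          split_ifs with h
          · rw [h, sub_self]
          · rw [hx n (by push_cast at *; omega), sub_zero])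
        exact ⟨b + c, by rw [map_add, ← sub_sub]; exact hc⟩
    obtain ⟨M, hM⟩ := hex x
    exact key (N + M).toNat x (hmono _ _ (by omega) hM)
  · intro b hb
    obtain ⟨g, a, hg, ha⟩ := exists_denom (fun _ : Unit => b)
    refine isUnit_of_am_mul (g := g) (a := a ()) ?_ (ha ())
    have h1 := congrArg (iota R) (ha ())
    rw [map_mul, iota_am, iota_am] at h1
    have h2 : iota0 R (a () - g) ∈ Filt R (-(g.natDegree : ℤ) + 1) := by
      have := Filt_mul _ _ _ _ (iota0_mem g) hb
      rw [mul_sub, h1, mul_one, ← map_sub] at this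
      exact this
    have h3 : a () = g + (a () - g) := by ring
    rw [h3]
    apply hg.add_of_left
    rw [degree_eq_natDegree hg.ne_zero, degree_lt_iff_coeff_zero]
    intro m hm
    have := h2 (-(m : ℤ)) (by omega)
    rw [iota0_coeff, if_pos (by omega)] at this
    simpa using this

end series

section laurent
open LaurentPolynomial

theorem pid_laurent (k : Type) [Field k] : IsPrincipalIdealRing (LaurentPolynomial k) := by
  refine ⟨fun J => ?_⟩
  have h1 := IsLocalization.map_comap (Submonoid.powers (X : k[X])) (LaurentPolynomial k) J
  obtain ⟨a, ha⟩ := (IsPrincipalIdealRing.principal (J.under k[X]))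
  refine ⟨⟨algebraMap k[X] (LaurentPolynomial k) a, ?_⟩⟩
  rw [← h1, ha]
  change Ideal.map _ (Ideal.span {a}) = Ideal.span _
  rw [Ideal.map_span]
  simp

theorem domain_laurent (k : Type) [Field k] : IsDomain (LaurentPolynomial k) := inferInstance

variable {R : Type} [CommRing R]

/-- `T` as a unit. -/
noncomputable def Tu (R : Type) [CommRing R] : (LaurentPolynomial R)ˣ where
  val := T 1
  inv := T (-1)
  val_inv := by rw [← T_add]; simp
  inv_val := by rw [← T_add]; simp

noncomputable def lmap {S : Type} [CommRing S] (f : R →+* S) :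
    LaurentPolynomial R →+* LaurentPolynomial S :=
  eval₂ (LaurentPolynomial.C.comp f) (Tu S)

theorem Tu_zpow (n : ℤ) : ((Tu R ^ n : (LaurentPolynomial R)ˣ) : LaurentPolynomial R) = T n := by
  rcases le_total 0 n with h | h
  · obtain ⟨m, rfl⟩ := Int.eq_ofNat_of_zero_le h
    rw [zpow_natCast, Units.val_pow_eq_pow_val]
    change T 1 ^ m = _
    rw [T_pow]; simp
  · obtain ⟨m, hm⟩ := Int.eq_ofNat_of_zero_le (neg_nonneg.2 h)
    obtain rfl : n = -(m : ℤ) := by omega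
    rw [_root_.zpow_neg, zpow_natCast, ← inv_pow, Units.val_pow_eq_pow_val]
    change T (-1) ^ m = _
    rw [T_pow]; simp

theorem lmap_toLaurent {S : Type} [CommRing S] (f : R →+* S) (p : R[X]) :
    lmap f (toLaurent p) = toLaurent (p.map f) := by
  rw [lmap, eval₂_toLaurent]
  induction p using Polynomial.induction_on' with
  | add p q hp hq => rw [Polynomial.eval₂_add, hp, hq, Polynomial.map_add, map_add]
  | monomial n a =>
    rw [Polynomial.eval₂_monomial, Polynomial.map_monomial, ← Polynomial.C_mul_X_pow_eq_monomial,
      toLaurent_C_mul_X_pow, ← Units.val_pow_eq_pow_val, ← zpow_natCast, Tu_zpow]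
    rfl

theorem lmap_surjective {S : Type} [CommRing S] (f : R →+* S) (hf : Function.Surjective f) :
    Function.Surjective (lmap f) := by
  intro p
  induction p using LaurentPolynomial.induction_on' with
  | add p q hp hq =>
    obtain ⟨a, ha⟩ := hp
    obtain ⟨b, hb⟩ := hq
    exact ⟨a + b, by rw [map_add, ha, hb]⟩
  | C_mul_T n a =>
    obtain ⟨r, rfl⟩ := hf a
    refine ⟨LaurentPolynomial.C r * T n, ?_⟩
    rw [lmap, eval₂_C_mul_T, Tu_zpow]
    rfl

theorem lmap_ker [IsLocalRing R] : RingHom.ker (lmap (IsLocalRing.residue R)) ≤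
    (IsLocalRing.maximalIdeal R).map (LaurentPolynomial.C : R →+* LaurentPolynomial R) := by
  intro p hp
  rw [RingHom.mem_ker] at hp
  obtain ⟨n, f, hf⟩ := exists_T_pow p
  have h1 : f.map (IsLocalRing.residue R) = 0 := by
    apply toLaurent_injective
    rw [← lmap_toLaurent, hf, map_mul, hp, zero_mul, map_zero]
  have h2 : f ∈ RingHom.ker (mapRingHom (IsLocalRing.residue R)) := h1
  rw [Polynomial.ker_mapRingHom, IsLocalRing.ker_residue] at h2
  have h3 := Ideal.mem_map_of_mem (toLaurent (R := R)) h2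
  rw [Ideal.map_map] at h3
  have h4 : (toLaurent (R := R)).comp Polynomial.C = LaurentPolynomial.C := by
    ext; simp
  rw [h4] at h3
  have h5 : p = toLaurent f * T (-n) := by
    rw [hf, mul_T_assoc]; simp
  rw [h5]
  exact Ideal.mul_mem_right _ _ h3

section psi

noncomputable def tu (R : Type) [CommRing R] [Nontrivial R] : (MonicLoc R)ˣ := (isUnit_am (R := R) monic_X).unit

variable [Nontrivial R]

theorem tu_val : (tu R : MonicLoc R) = am R X := IsUnit.unit_spec _

theorem tu_mul : am R X * (↑(tu R)⁻¹ : MonicLoc R) = 1 := by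
  rw [← tu_val, Units.mul_inv]

noncomputable def psi1 (R : Type) [CommRing R] [Nontrivial R] : LaurentPolynomial R →+* MonicLoc R :=
  eval₂ ((am R).comp Polynomial.C) (tu R)

noncomputable def psi2 (R : Type) [CommRing R] [Nontrivial R] : LaurentPolynomial R →+* MonicLoc R :=
  (psi1 R).comp (invert (R := R) : LaurentPolynomial R →+* LaurentPolynomial R)

theorem psi1_toLaurent (p : R[X]) : psi1 R (toLaurent p) = am R p := by
  rw [psi1, eval₂_toLaurent, tu_val, ← Polynomial.hom_eval₂, Polynomial.eval₂_C_X]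

theorem psi1_comp : (psi1 R).comp toLaurent = am R := RingHom.ext psi1_toLaurent

theorem psi2_apply (p) : psi2 R p = psi1 R (invert p) := rfl

theorem psi1_T (n : ℕ) : psi1 R (T n) = am R X ^ n := by
  rw [psi1, eval₂_T_n, tu_val]

theorem psi1_T_neg (n : ℕ) : psi1 R (T (-n)) = (↑(tu R)⁻¹ : MonicLoc R) ^ n := by
  rw [psi1, eval₂_T_neg_n]

theorem psi1_injective : Function.Injective (psi1 R) := by
  rw [injective_iff_map_eq_zero]
  intro p hp
  obtain ⟨n, f, hf⟩ := exists_T_pow p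
  have h1 : f = 0 := by
    apply am_injective
    rw [← psi1_toLaurent, hf, map_mul, hp, zero_mul, map_zero]
  have h5 : p = toLaurent f * T (-n) := by
    rw [hf, mul_T_assoc]; simp
  rw [h5, h1]; simp

theorem exists_monic_laurent (I : Ideal (LaurentPolynomial R))
    (h : I.map (psi1 R) = ⊤) : ∃ f : R[X], f.Monic ∧ toLaurent f ∈ I := by
  have h1 : (I.comap (toLaurent (R := R))).map (toLaurent (R := R)) = I :=
    IsLocalization.map_comap (Submonoid.powers (X : R[X])) (LaurentPolynomial R) I
  have h2 : (I.comap (toLaurent (R := R))).map (am R) = ⊤ := by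
    rw [← psi1_comp, ← Ideal.map_map, h1, h]
  obtain ⟨f, hf, hfm⟩ := exists_monic_of_map_eq_top _ h2
  exact ⟨f, hfm, hf⟩

theorem exists_monic_laurent' (I : Ideal (LaurentPolynomial R))
    (h : I.map (psi2 R) = ⊤) : ∃ f : R[X], f.Monic ∧ invert (toLaurent f) ∈ I := by
  rw [psi2, ← Ideal.map_map] at h
  obtain ⟨f, hfm, hf⟩ := exists_monic_laurent _ h
  obtain ⟨x, hx, hxf⟩ := (Ideal.mem_map_iff_of_surjective _ (invert (R := R)).surjective).1 hf
  refine ⟨f, hfm, ?_⟩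
  have : invert x = toLaurent f := hxf
  rw [← this, involutive_invert]
  exact hx

end psi

theorem H2_laurent [IsLocalRing R] (I : Ideal (LaurentPolynomial R))
    (hI : I.map (lmap (IsLocalRing.residue R)) = ⊤)
    (h1 : I.map (psi1 R) = ⊤) (h2 : I.map (psi2 R) = ⊤) : I = ⊤ := by
  refine ideal_eq_top_aux (LaurentPolynomial.C : R →+* LaurentPolynomial R)
    (lmap (IsLocalRing.residue R))
    (lmap_surjective _ IsLocalRing.residue_surjective) lmap_ker I hI ?_
  obtain ⟨f1, hf1, hf1I⟩ := exists_monic_laurent I h1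
  obtain ⟨f2, hf2, hf2I⟩ := exists_monic_laurent' I h2
  set c := (Ideal.Quotient.mk I).comp (LaurentPolynomial.C : R →+* LaurentPolynomial R) with hc
  have key1 : ∀ p : R[X], Polynomial.eval₂ c (Ideal.Quotient.mk I (T 1)) p =
      Ideal.Quotient.mk I (toLaurent p) := by
    intro p
    have : eval₂RingHom c (Ideal.Quotient.mk I (T 1)) = (Ideal.Quotient.mk I).comp toLaurent := by
      apply Polynomial.ringHom_ext
      · intro a; simp [hc]
      · simp
    exact RingHom.congr_fun this p
  have key2 : ∀ p : R[X], Polynomial.eval₂ c (Ideal.Quotient.mk I (T (-1))) p =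
      Ideal.Quotient.mk I (invert (toLaurent p)) := by
    intro p
    have : eval₂RingHom c (Ideal.Quotient.mk I (T (-1))) = ((Ideal.Quotient.mk I).comp
        (invert (R := R) : LaurentPolynomial R →+* LaurentPolynomial R)).comp toLaurent := by
      apply Polynomial.ringHom_ext
      · intro a; simp [hc]
      · simp
    exact RingHom.congr_fun this p
  have i1 : c.IsIntegralElem (Ideal.Quotient.mk I (T 1)) :=
    ⟨f1, hf1, by rw [key1]; exact Ideal.Quotient.eq_zero_iff_mem.2 hf1I⟩
  have i2 : c.IsIntegralElem (Ideal.Quotient.mk I (T (-1))) :=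
    ⟨f2, hf2, by rw [key2]; exact Ideal.Quotient.eq_zero_iff_mem.2 hf2I⟩
  intro y
  obtain ⟨p, rfl⟩ := Ideal.Quotient.mk_surjective y
  obtain ⟨n, f, hf⟩ := exists_T_pow p
  have h5 : p = toLaurent f * invert (toLaurent (X ^ n)) := by
    rw [hf, toLaurent_X_pow, invert_T, mul_T_assoc]; simp
  rw [h5, map_mul, ← key1, ← key2]
  exact RingHom.IsIntegralElem.mul c (isIntegral_poly _ _ i1 _) (isIntegral_poly _ _ i2 _)

theorem rowH_laurent_of_monicLoc [IsLocalRing R] (hB : RowH (MonicLoc R)) :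
    RowH (LaurentPolynomial R) := by
  have : IsPrincipalIdealRing (LaurentPolynomial (IsLocalRing.ResidueField R)) := pid_laurent _
  rw [← isHermite_iff_rowH]
  apply KerH.isHermite
  have hh : ∀ a b : MonicLoc R, a = b → IsUnit b → IsUnit a := fun _ _ h hb => h ▸ hb
  have hs := tu_mul (R := R)
  refine kerH_of_abs (J := Bool) (fun j => cond j (psi1 R) (psi2 R))
    (lmap (IsLocalRing.residue R)) (lmap_surjective _ IsLocalRing.residue_surjective)
    true psi1_injective ?_ ?_ ?_ hB
  · intro I h1 h2
    exact H2_laurent I h1 (h2 true) (h2 false)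
  · intro n _ u x hux
    obtain ⟨g1, e1, hg1, he1⟩ := exists_denom (x true)
    obtain ⟨g2, e2, hg2, he2⟩ := exists_denom (x false)
    have a1 : u true ⬝ᵥ (fun i => am R (e1 i)) = am R g1 := by
      have : (fun i => am R (e1 i)) = am R g1 • x true := by ext i; simp [← he1]
      rw [this, dotProduct_smul, hux]; simp
    have a2 : u false ⬝ᵥ (fun i => am R (e2 i)) = am R g2 := by
      have : (fun i => am R (e2 i)) = am R g2 • x false := by ext i; simp [← he2]
      rw [this, dotProduct_smul, hux]; simp
    obtain ⟨N1, hN1⟩ := growth (am R g1) (isUnit_am hg1) 0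
      (u true ⬝ᵥ fun i => psi1 R (invert (toLaurent (e2 i))))
    obtain ⟨N2, hN2⟩ := growth (am R g2) (isUnit_am hg2) 0
      (u false ⬝ᵥ fun i => psi1 R (invert (toLaurent (e1 i))))
    refine ⟨fun i => T ((N1 + N2 : ℕ) : ℤ) * toLaurent (e1 i) +
      T (-((N1 + N2 : ℕ) : ℤ)) * invert (toLaurent (e2 i)), ?_⟩
    rintro (_ | _)
    · have := hN2 (N1 + N2) (by omega) (N1 + N2) _ hs
      rw [← a2, add_zero] at this
      refine hh _ _ ?_ this
      rw [← smul_eq_mul, ← smul_eq_mul, ← dotProduct_smul, ← dotProduct_smul, ← dotProduct_add]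
      congr 1
      ext i
      simp only [cond_false, psi2_apply, map_add, map_mul, invert_T, neg_neg, psi1_T, psi1_T_neg,
        Pi.add_apply, Pi.smul_apply, smul_eq_mul]
      rw [involutive_invert, psi1_toLaurent, add_comm]
    · have := hN1 (N1 + N2) (by omega) (N1 + N2) _ hs
      rw [← a1, add_zero] at this
      refine hh _ _ ?_ this
      rw [← smul_eq_mul, ← smul_eq_mul, ← dotProduct_smul, ← dotProduct_smul, ← dotProduct_add]
      congr 1
      ext i
      simp only [cond_true, map_add, map_mul, psi1_T, psi1_T_neg,
        Pi.add_apply, Pi.smul_apply, smul_eq_mul, psi1_toLaurent]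
  · intro b
    obtain ⟨N1, hN1⟩ := growth (1 : MonicLoc R) isUnit_one (b true) 1
    obtain ⟨N2, hN2⟩ := growth (1 : MonicLoc R) isUnit_one (b false) 1
    refine ⟨T ((N1 + N2 : ℕ) : ℤ) + T (-((N1 + N2 : ℕ) : ℤ)), ?_⟩
    rintro (_ | _)
    · have := hN2 (N1 + N2) (by omega) (N1 + N2) _ hs
      refine hh _ _ ?_ this
      simp only [cond_false, psi2_apply, map_add, invert_T, neg_neg, psi1_T, psi1_T_neg]
      ring
    · have := hN1 (N1 + N2) (by omega) (N1 + N2) _ hs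
      refine hh _ _ ?_ this
      simp only [cond_true, map_add, psi1_T, psi1_T_neg]
      ring

end laurent

end HermiteAux

/-- **Theorem 2.** For a commutative local ring `R`, the following are equivalent:
(i) `R[t]` is Hermite; (ii) `R[t,t⁻¹]` is Hermite; (iii) `R⟨t⟩` is Hermite;
(iv) `R((t))` is Hermite. -/
theorem isHermite_tfae_of_local (R : Type) [CommRing R] [IsLocalRing R] :
    List.TFAE
      [IsHermite (Polynomial R),
       IsHermite (LaurentPolynomial R),
       IsHermite (MonicLoc R),
       IsHermite (LaurentSeries R)] := by
  have hL : Nontrivial (LaurentSeries R) := inferInstanceAs (Nontrivial (HahnSeries ℤ R))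
  rw [HermiteAux.isHermite_iff_rowH, HermiteAux.isHermite_iff_rowH,
    HermiteAux.isHermite_iff_rowH, HermiteAux.isHermite_iff_rowH]
  tfae_have 3 → 1 := HermiteAux.rowH_poly_of_monicLoc
  tfae_have 3 → 2 := HermiteAux.rowH_laurent_of_monicLoc
  tfae_have 1 → 3 := HermiteAux.rowH_monicLoc_of (RingHom.id _) (HermiteAux.am R) (by ext <;> simp)
  tfae_have 2 → 3 := HermiteAux.rowH_monicLoc_of toLaurent (HermiteAux.psi1 R)
    HermiteAux.psi1_comp
  tfae_have 3 ↔ 4 := HermiteAux.rowH_series_iff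
  tfae_finish
end

section
/- Fix a commutative ring R and a natural number r ≥ 2. Let A be a commutative R-algebra and let (z₀, …, z_r) be a unimodular row over A((t)). Then there exist k ∈ ℕ, an R-algebra homomorphism φ : A^R_{r,k} → A, and a matrix M ∈ GL_{r+1}(A((t))) such that (z₀, …, z_r) = (φ((t))(x₀), …, φ((t))(x_r))·M, where φ((t)) : A^R_{r,k}((t)) → A((t)) is the ring homomorphism applying φ to each coefficient of a formal Laurent series, and x_i = Σ_{j≥0} x̄_{i,j} t^j ∈ A^R_{r,k}[[t]]. -/
/-- Unimodular row: the entries generate the unit ideal. -/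
def IsUnimodular {A : Type} [CommRing A] {n : ℕ} (v : Fin n → A) : Prop :=
  Ideal.span (Set.range v) = ⊤

/-- The set `S_r` of variables `x_{i,j}` (left summand) and `y_{i,j}` (right summand),
for `0 ≤ i ≤ r` and `j ∈ ℕ`. -/
abbrev UnivVars (r : ℕ) : Type := (Fin (r + 1) × ℕ) ⊕ (Fin (r + 1) × ℕ)

/-- The polynomial `p_n = Σ_{i=0}^r Σ_{j=0}^n x_{i,j} y_{i,n-j}` in `R[S_r]`. -/
noncomputable def pUniv (R : Type) [CommRing R] (r n : ℕ) : MvPolynomial (UnivVars r) R :=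
  ∑ i : Fin (r + 1), ∑ j ∈ Finset.range (n + 1),
    MvPolynomial.X (Sum.inl (i, j)) * MvPolynomial.X (Sum.inr (i, n - j))

/-- The ideal `J_k ⊆ R[S_r]` generated by the `p_n` with `n ≠ k`. -/
noncomputable def JUniv (R : Type) [CommRing R] (r k : ℕ) :
    Ideal (MvPolynomial (UnivVars r) R) :=
  Ideal.span {q | ∃ n : ℕ, n ≠ k ∧ q = pUniv R r n}

/-- The ring `B^R_{r,k} = R[S_r]/J_k`. -/
def BUniv (R : Type) [CommRing R] (r k : ℕ) : Type :=
  MvPolynomial (UnivVars r) R ⧸ JUniv R r k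

noncomputable instance (R : Type) [CommRing R] (r k : ℕ) : CommRing (BUniv R r k) :=
  inferInstanceAs (CommRing (MvPolynomial (UnivVars r) R ⧸ JUniv R r k))

/-- The image `p̄_k` of `p_k` in `B^R_{r,k}`. -/
noncomputable def pBar (R : Type) [CommRing R] (r k : ℕ) : BUniv R r k :=
  Ideal.Quotient.mk (JUniv R r k) (pUniv R r k)

/-- The ring `A^R_{r,k}`, the localization of `B^R_{r,k}` at `p̄_k`. -/
def AUniv (R : Type) [CommRing R] (r k : ℕ) : Type :=
  Localization.Away (pBar R r k)

noncomputable instance (R : Type) [CommRing R] (r k : ℕ) : CommRing (AUniv R r k) :=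
  inferInstanceAs (CommRing (Localization.Away (pBar R r k)))

noncomputable instance (R : Type) [CommRing R] (r k : ℕ) :
    Algebra (BUniv R r k) (AUniv R r k) :=
  inferInstanceAs (Algebra (BUniv R r k) (Localization.Away (pBar R r k)))

/-- The image `x̄_{i,j}` of the variable `x_{i,j}` in `A^R_{r,k}`. -/
noncomputable def xBar (R : Type) [CommRing R] (r k : ℕ) (i : Fin (r + 1)) (j : ℕ) :
    AUniv R r k :=
  algebraMap (BUniv R r k) (AUniv R r k)
    (Ideal.Quotient.mk (JUniv R r k) (MvPolynomial.X (Sum.inl (i, j))))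

/-- The image `ȳ_{i,j}` of the variable `y_{i,j}` in `A^R_{r,k}`. -/
noncomputable def yBar (R : Type) [CommRing R] (r k : ℕ) (i : Fin (r + 1)) (j : ℕ) :
    AUniv R r k :=
  algebraMap (BUniv R r k) (AUniv R r k)
    (Ideal.Quotient.mk (JUniv R r k) (MvPolynomial.X (Sum.inr (i, j))))

/-- The power series `x_i = Σ_j x̄_{i,j} tʲ` over `A^R_{r,k}`. -/
noncomputable def xSeries (R : Type) [CommRing R] (r k : ℕ) (i : Fin (r + 1)) :
    PowerSeries (AUniv R r k) :=
  PowerSeries.mk (fun j => xBar R r k i j)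

/-- The power series `y_i = Σ_j ȳ_{i,j} tʲ` over `A^R_{r,k}`. -/
noncomputable def ySeries (R : Type) [CommRing R] (r k : ℕ) (i : Fin (r + 1)) :
    PowerSeries (AUniv R r k) :=
  PowerSeries.mk (fun j => yBar R r k i j)

noncomputable instance (R : Type) [CommRing R] (r k : ℕ) : Algebra R (BUniv R r k) :=
  inferInstanceAs (Algebra R (MvPolynomial (UnivVars r) R ⧸ JUniv R r k))

noncomputable instance (R : Type) [CommRing R] (r k : ℕ) : Algebra R (AUniv R r k) :=
  ((algebraMap (BUniv R r k) (AUniv R r k)).comp (algebraMap R (BUniv R r k))).toAlgebra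

/-- Clearing denominators simultaneously in a finite family of Laurent series. -/
theorem exists_clear_denom {A : Type} [CommRing A] {n : ℕ} (z : Fin n → LaurentSeries A) :
    ∃ (N : ℕ) (x : Fin n → PowerSeries A), ∀ i,
      HahnSeries.ofPowerSeries ℤ A (x i)
        = HahnSeries.ofPowerSeries ℤ A (PowerSeries.X ^ N) * z i := by
  obtain ⟨⟨b, hb⟩, h⟩ := IsLocalization.exist_integer_multiples_of_finite
    (Submonoid.powers (PowerSeries.X : PowerSeries A)) z
  obtain ⟨N, rfl⟩ := hb
  choose x hx using h
  refine ⟨N, x, fun i => ?_⟩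
  have := hx i
  rw [Algebra.smul_def] at this
  exact this

/-- Power series with `∑ x_i y_i = t ^ k` give a homomorphism out of the universal ring. -/
theorem exists_univ_hom (R : Type) [CommRing R] (r k : ℕ) (A : Type) [CommRing A] [Algebra R A]
    (x y : Fin (r + 1) → PowerSeries A) (h : ∑ i, x i * y i = PowerSeries.X ^ k) :
    ∃ φ : AUniv R r k →ₐ[R] A, ∀ i, PowerSeries.map φ.toRingHom (xSeries R r k i) = x i := by
  let f : MvPolynomial (UnivVars r) R →ₐ[R] A := MvPolynomial.aeval
    (Sum.elim (fun p => PowerSeries.coeff p.2 (x p.1)) (fun p => PowerSeries.coeff p.2 (y p.1)))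
  have hf : ∀ n, f (pUniv R r n) = if n = k then 1 else 0 := by
    intro n
    have := congrArg (PowerSeries.coeff n) h
    rw [PowerSeries.coeff_X_pow] at this
    rw [← this]
    simp only [pUniv, map_sum, map_mul, PowerSeries.coeff_mul, f, MvPolynomial.aeval_X,
      Sum.elim_inl, Sum.elim_inr]
    refine Finset.sum_congr rfl fun i _ => ?_
    rw [Finset.Nat.sum_antidiagonal_eq_sum_range_succ_mk]
  have hJ : ∀ a ∈ JUniv R r k, f a = 0 := by
    have : JUniv R r k ≤ RingHom.ker f.toRingHom := by
      refine Ideal.span_le.mpr ?_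
      rintro q ⟨n, hn, rfl⟩
      change f _ = 0
      rw [hf, if_neg hn]
    exact fun a ha => this ha
  let g : BUniv R r k →+* A := Ideal.Quotient.lift (JUniv R r k) f.toRingHom hJ
  have hg : ∀ a, g (Ideal.Quotient.mk (JUniv R r k) a) = f a := fun a => rfl
  have hu : IsUnit (g (pBar R r k)) := by
    have : g (pBar R r k) = 1 := by
      rw [pBar, hg, hf, if_pos rfl]
    rw [this]
    exact isUnit_one
  have : IsLocalization.Away (pBar R r k) (AUniv R r k) :=
    inferInstanceAs (IsLocalization.Away (pBar R r k) (Localization.Away (pBar R r k)))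
  let φ : AUniv R r k →+* A := IsLocalization.Away.lift (pBar R r k) hu
  have hφ : ∀ b, φ (algebraMap (BUniv R r k) (AUniv R r k) b) = g b :=
    fun b => IsLocalization.Away.lift_eq (pBar R r k) hu b
  refine ⟨{ φ with commutes' := fun a => ?_ }, fun i => ?_⟩
  · change φ (algebraMap (BUniv R r k) (AUniv R r k) (algebraMap R (BUniv R r k) a)) = _
    rw [hφ]
    change f (algebraMap R _ a) = _
    exact f.commutes a
  · ext j
    rw [PowerSeries.coeff_map, xSeries, PowerSeries.coeff_mk]
    change φ (xBar R r k i j) = _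
    refine (hφ _).trans ?_
    refine (hg _).trans ?_
    simp [f]

/-- **Proposition (universality).** Let `A` be a commutative `R`-algebra and `(z₀, …, z_r)` a
unimodular row over `A((t))`.  Then there exist `k ∈ ℕ`, an `R`-algebra homomorphism
`φ : A^R_{r,k} → A` and an invertible matrix `M` over `A((t))` such that
`(z₀, …, z_r) = (φ((t))(x₀), …, φ((t))(x_r))·M`, where `φ((t))` applies `φ` to each
coefficient of a formal (Laurent) series. -/
theorem exists_univ_specialization (R : Type) [CommRing R] (r : ℕ) (hr : 2 ≤ r)
    (A : Type) [CommRing A] [Algebra R A]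
    (z : Fin (r + 1) → LaurentSeries A) (hz : IsUnimodular z) :
    ∃ (k : ℕ) (φ : AUniv R r k →ₐ[R] A)
      (M : Matrix (Fin (r + 1)) (Fin (r + 1)) (LaurentSeries A)),
      IsUnit M ∧
      z = Matrix.vecMul
        (fun i => HahnSeries.ofPowerSeries ℤ A
          (PowerSeries.map φ.toRingHom (xSeries R r k i))) M := by
  have h1 : (1 : LaurentSeries A) ∈ Ideal.span (Set.range z) := by
    rw [show Ideal.span (Set.range z) = ⊤ from hz]
    exact Submodule.mem_top
  obtain ⟨w, hw⟩ := Ideal.mem_span_range_iff_exists_fun.mp h1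
  obtain ⟨N, x, hx⟩ := exists_clear_denom z
  obtain ⟨L, y, hy⟩ := exists_clear_denom w
  have hxy : ∑ i, x i * y i = PowerSeries.X ^ (N + L) := by
    apply HahnSeries.ofPowerSeries_injective (Γ := ℤ)
    rw [map_sum, pow_add, map_mul,
      ← mul_one (HahnSeries.ofPowerSeries ℤ A (PowerSeries.X ^ N) * _), ← hw, Finset.mul_sum]
    refine Finset.sum_congr rfl fun i _ => ?_
    rw [map_mul, hx, hy]
    ring
  obtain ⟨φ, hφ⟩ := exists_univ_hom R r (N + L) A x y hxy
  have hu : IsUnit (HahnSeries.ofPowerSeries ℤ A (PowerSeries.X ^ N)) :=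
    IsLocalization.map_units (LaurentSeries A)
      (⟨PowerSeries.X ^ N, N, rfl⟩ : Submonoid.powers (PowerSeries.X : PowerSeries A))
  obtain ⟨u, hu⟩ := hu
  refine ⟨N + L, φ, Matrix.scalar _ (↑u⁻¹ : LaurentSeries A), u⁻¹.isUnit.map (Matrix.scalar _), ?_⟩
  funext i
  simp only [hφ, hx, ← hu]
  simp [Matrix.scalar_apply, Matrix.vecMul_diagonal]
  rw [mul_comm (u : LaurentSeries A) (z i), mul_assoc, Units.mul_inv, mul_one]
end
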